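/- arXiv:1409.2057 — 4 statements merged into one kernel-verified Lean document; each statement's English description precedes it below -/
import Mathlib

section
/- If F is an intersecting family of perfect matchings of K_{2n} with |F| = (2n-3)!!, then F = F_{ij} for some edge {i,j}, i.e., all matchings in F contain a common fixed edge. -/
open scoped Nat

/-- A perfect matching of `K_{2n}` viewed as a fixed-point-free involution of the
vertex set `Fin (2*n)`. -/
def IsPM {N : ℕ} (f : Equiv.Perm (Fin N)) : Prop :=
  Function.Involutive f ∧ ∀ i, f i ≠ i

/-- The set of perfect matchings of `K_{2n}`. -/
abbrev PMV (n : ℕ) := {f : Equiv.Perm (Fin (2 * n)) // IsPM f}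

namespace EKRProof

open Finset Classical

variable {n : ℕ}

/-- members of `F` agreeing with `g` on `R` -/
noncomputable def fam (F : Finset (PMV n)) (g : PMV n) (R : Finset (Fin (2 * n))) :
    Finset (PMV n) := F.filter (fun m => ∀ i ∈ R, m.1 i = g.1 i)

/-- `R` contains at most one endpoint of each edge of `g` -/
def Ind (g : PMV n) (R : Finset (Fin (2 * n))) : Prop := ∀ i ∈ R, g.1 i ∉ R

/-- vertices covered by the edges of `g` at `R` -/
noncomputable def cov (g : PMV n) (R : Finset (Fin (2 * n))) : Finset (Fin (2 * n)) :=
  R ∪ R.image g.1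

lemma mem_cov (g : PMV n) (R) (x) : x ∈ cov g R ↔ x ∈ R ∨ g.1 x ∈ R := by
  unfold cov
  simp only [mem_union, mem_image]
  constructor
  · rintro (h | ⟨a, ha, rfl⟩)
    · exact Or.inl h
    · right; rwa [g.2.1 a]
  · rintro (h | h)
    · exact Or.inl h
    · right; exact ⟨_, h, g.2.1 x⟩

lemma card_cov (g : PMV n) (R) (h : Ind g R) : (cov g R).card = 2 * R.card := by
  unfold cov
  rw [card_union_of_disjoint, card_image_of_injective _ g.1.injective]
  · omega
  rw [Finset.disjoint_left]
  intro a ha hb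
  obtain ⟨b, hb2, rfl⟩ := mem_image.1 hb
  exact h b hb2 ha

lemma branch (F : Finset (PMV n)) (g : PMV n) (R : Finset (Fin (2 * n)))
    (W : Finset (Fin (2 * n) × Fin (2 * n))) (B : ℕ)
    (hc : ∀ m ∈ fam F g R, ∃ p ∈ W, m.1 p.1 = p.2)
    (hB : ∀ g' ∈ fam F g R, ∀ p ∈ W, g'.1 p.1 = p.2 → (fam F g' (insert p.1 R)).card ≤ B) :
    (fam F g R).card ≤ W.card * B := by
  have hsub : fam F g R ⊆ W.biUnion (fun p => (fam F g R).filter (fun m => m.1 p.1 = p.2)) := by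
    intro m hm
    obtain ⟨p, hp, h⟩ := hc m hm
    simp only [mem_biUnion, mem_filter]
    exact ⟨p, hp, hm, h⟩
  refine (card_le_card hsub).trans (card_biUnion_le_card_mul _ _ _ ?_)
  intro p hp
  rcases Finset.eq_empty_or_nonempty ((fam F g R).filter (fun m => m.1 p.1 = p.2)) with h | ⟨g', hg'⟩
  · rw [h]; simp
  · have hg := mem_filter.1 hg'
    refine le_trans (card_le_card ?_) (hB g' hg.1 p hp hg.2)
    intro m hm
    have hm := mem_filter.1 hm
    unfold fam at hm hg ⊢
    simp only [mem_filter] at hm hg ⊢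
    refine ⟨hm.1.1, ?_⟩
    intro i hi
    rcases mem_insert.1 hi with rfl | hi
    · rw [hm.2, hg.2]
    · rw [hm.1.2 i hi, hg.1.2 i hi]

lemma ind_insert {F : Finset (PMV n)} {g g' : PMV n} {R} (h : Ind g R) (hg' : g' ∈ fam F g R) {x}
    (hx : x ∉ cov g R) : Ind g' (insert x R) ∧ (insert x R).card = R.card + 1 := by
  rw [mem_cov, not_or] at hx
  unfold fam at hg'
  simp only [mem_filter] at hg'
  refine ⟨?_, card_insert_of_notMem hx.1⟩
  intro i hi
  rw [mem_insert, not_or]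
  rcases mem_insert.1 hi with rfl | hi
  · refine ⟨g'.2.2 _, fun h2 => hx.2 ?_⟩
    have := hg'.2 _ h2
    rw [g'.2.1] at this
    have h3 : g.1 i = g'.1 i := by
      conv_lhs => rw [this]
      exact g.2.1 _
    rwa [h3]
  · rw [hg'.2 i hi]
    refine ⟨?_, h i hi⟩
    rintro rfl
    apply hx.2
    rwa [g.2.1]

/-- closedness of the complement of the covered set -/
lemma cov_agree {F : Finset (PMV n)} {g m : PMV n} {R} (hm : m ∈ fam F g R) {x} :
    x ∈ cov g R ↔ m.1 x ∈ cov g R := by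
  unfold fam at hm
  simp only [mem_filter] at hm
  have key : cov g R = cov m R := by
    unfold cov
    congr 1
    apply image_congr
    intro i hi
    exact (hm.2 i hi).symm
  rw [key, mem_cov, mem_cov, m.2.1]
  exact or_comm

lemma df_succ (k : ℕ) : (2 * (k + 1) - 1)‼ = (2 * k + 1) * (2 * k - 1)‼ := by
  rcases k with _ | k
  · rfl
  · have h1 : 2 * (k + 1 + 1) - 1 = (2 * k + 1) + 2 := by omega
    have h2 : 2 * (k + 1) - 1 = 2 * k + 1 := by omega
    rw [h1, h2, Nat.doubleFactorial_add_two]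
    ring

lemma base (F : Finset (PMV n)) (k : ℕ) : ∀ (g : PMV n) (R) (_ : Ind g R)
    (_ : R.card + k = n), (fam F g R).card ≤ (2 * k - 1)‼ := by
  induction k with
  | zero =>
    intro g R h hk
    have hA : cov g R = univ := by
      rw [← card_eq_iff_eq_univ, card_cov g R h, Fintype.card_fin]; omega
    show _ ≤ 1
    rw [card_le_one]
    have : ∀ a ∈ fam F g R, a = g := by
      intro a ha
      unfold fam at ha
      simp only [mem_filter] at ha
      apply Subtype.ext
      ext1 x
      have hx : x ∈ cov g R := by rw [hA]; exact mem_univ x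
      rcases (mem_cov _ _ _).1 hx with hx | hx
      · exact ha.2 x hx
      · have := ha.2 _ hx
        rw [g.2.1] at this
        rw [← a.2.1 (g.1 x), this]
    intro a ha b hb
    rw [this a ha, this b hb]
  | succ k ih =>
    intro g R h hk
    have hcard := card_cov g R h
    have : ∃ v, v ∉ cov g R := by
      by_contra hcon
      push Not at hcon
      have := (card_eq_iff_eq_univ _).2 (eq_univ_iff_forall.2 hcon)
      rw [hcard, Fintype.card_fin] at this
      omega
    obtain ⟨v, hv⟩ := this
    have hb := branch F g R ((insert v (cov g R))ᶜ.image (fun w => (v, w))) ((2 * k - 1)‼) ?_ ?_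
    · refine hb.trans ?_
      rw [df_succ]
      apply Nat.mul_le_mul_right
      refine card_image_le.trans ?_
      rw [card_compl, card_insert_of_notMem hv, hcard, Fintype.card_fin]
      omega
    · intro m hm
      refine ⟨(v, m.1 v), ?_, rfl⟩
      apply mem_image_of_mem
      rw [mem_compl, mem_insert, not_or]
      refine ⟨m.2.2 v, fun hh => hv ((cov_agree hm).2 hh)⟩
    · intro g' hg' p hp hpe
      obtain ⟨w, hw, rfl⟩ := mem_image.1 hp
      obtain ⟨h1, h2⟩ := ind_insert h hg' hv
      exact ih g' _ h1 (by simp only; omega)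

/-- one representative of each edge of `m` in the complement of `U` -/
noncomputable def reps (m : PMV n) (U : Finset (Fin (2 * n))) : Finset (Fin (2 * n)) :=
  univ.filter (fun x => x ∉ U ∧ m.1 x ∉ U ∧ x < m.1 x)

lemma card_reps (m : PMV n) (U) : 2 * (reps m U).card + U.card ≤ 2 * n := by
  have hI : Ind m (reps m U) := by
    intro i hi hj
    unfold reps at hi hj
    simp only [mem_filter, mem_univ, true_and] at hi hj
    rw [m.2.1] at hj
    exact lt_asymm hi.2.2 hj.2.2
  have hd : Disjoint (cov m (reps m U)) U := by
    rw [Finset.disjoint_left]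
    intro a ha hu
    rcases (mem_cov _ _ _).1 ha with h | h
    · unfold reps at h
      simp only [mem_filter, mem_univ, true_and] at h
      exact h.1 hu
    · unfold reps at h
      simp only [mem_filter, mem_univ, true_and] at h
      rw [m.2.1] at h
      exact h.2.1 hu
  have := card_le_univ (cov m (reps m U) ∪ U)
  rw [card_union_of_disjoint hd, card_cov _ _ hI, Fintype.card_fin] at this
  exact this

lemma exists_rep (m m' : PMV n) (U) (x) (hx : m'.1 x = m.1 x) (h1 : x ∉ U) (h2 : m.1 x ∉ U) :
    ∃ p ∈ (reps m U).image (fun x => (x, m.1 x)), m'.1 p.1 = p.2 := by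
  rcases lt_trichotomy x (m.1 x) with h | h | h
  · refine ⟨(x, m.1 x), mem_image_of_mem _ ?_, hx⟩
    unfold reps; simp only [mem_filter, mem_univ, true_and]; exact ⟨h1, h2, h⟩
  · exact absurd h.symm (m.2.2 x)
  · refine ⟨(m.1 x, m.1 (m.1 x)), mem_image_of_mem (fun x => (x, m.1 x)) ?_, ?_⟩
    · unfold reps; simp only [mem_filter, mem_univ, true_and]
      rw [m.2.1]; exact ⟨h2, h1, h⟩
    · simp only
      rw [m.2.1, ← hx, m'.2.1]

/-- covers -/
def IsCov (F : Finset (PMV n)) (T : Finset (Fin (2 * n) × Fin (2 * n))) : Prop :=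
  ∀ m ∈ F, ∃ p ∈ T, m.1 p.1 = p.2

/-- the recursive bound -/
def Gf (k : ℕ) : ℕ → ℕ
  | 0 => (2 * k - 1)‼
  | d + 1 => (k + d + 1) * Gf k d

lemma step (F : Finset (PMV n)) (hF : ∀ m ∈ F, ∀ m' ∈ F, ∃ i, m.1 i = m'.1 i)
    (g : PMV n) (R) (hR : Ind g R) (hnc : ¬ IsCov F (R.image (fun i => (i, g.1 i)))) (B : ℕ)
    (hB : ∀ g' R', Ind g' R' → R'.card = R.card + 1 → (fam F g' R').card ≤ B) :
    ∃ c, 2 * c + 2 * R.card ≤ 2 * n ∧ (R.card = 1 → c + 2 ≤ n) ∧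
      (fam F g R).card ≤ c * B := by
  unfold IsCov at hnc
  push Not at hnc
  obtain ⟨m, hm, hne⟩ := hnc
  have hne : ∀ i ∈ R, m.1 i ≠ g.1 i := fun i hi => hne (i, g.1 i) (mem_image_of_mem _ hi)
  set U := cov g R ∪ (cov g R).image m.1 with hU
  have hUc := card_reps m U
  refine ⟨(reps m U).card, ?_, ?_, ?_⟩
  · have : (cov g R).card ≤ U.card := card_le_card subset_union_left
    rw [card_cov g R hR] at this
    omega
  · intro h1
    obtain ⟨a, rfl⟩ := card_eq_one.1 h1
    have ha := hne a (mem_singleton_self a)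
    have hd : Disjoint (cov g {a}) ((cov g {a}).image m.1) := by
      rw [Finset.disjoint_left]
      intro x hx hy
      obtain ⟨y, hy', rfl⟩ := mem_image.1 hy
      clear hy
      rename' hy' => hy
      unfold cov at hx hy
      simp only [image_singleton, mem_union, mem_singleton] at hx hy
      rcases hy with hy | hy <;> subst hy
      · rcases hx with hx | hx
        · exact m.2.2 _ hx
        · exact ha hx
      · rcases hx with hx | hx
        · apply ha
          rw [← m.2.1 (g.1 a), hx]
        · exact m.2.2 _ hx
    have : U.card = 4 := by
      rw [hU, card_union_of_disjoint hd, card_image_of_injective _ m.1.injective,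
        card_cov g _ hR]
      simp
    omega
  · refine (branch F g R ((reps m U).image (fun x => (x, m.1 x))) B ?_ ?_).trans
      (Nat.mul_le_mul_right _ card_image_le)
    · intro m' hm'
      have hm'2 := hm'
      unfold fam at hm'2
      simp only [mem_filter] at hm'2
      obtain ⟨x, hx⟩ := hF m' hm'2.1 m hm
      have hxA : x ∉ cov g R := by
        rw [mem_cov, not_or]
        constructor
        · intro hxR
          exact hne x hxR (by rw [← hx, hm'2.2 x hxR])
        · intro hxR
          have e1 := hm'2.2 _ hxR
          rw [g.2.1] at e1
          have e2 : m'.1 x = g.1 x := by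
            rw [← m'.2.1 (g.1 x), e1]
          apply hne _ hxR
          rw [g.2.1, ← e2, hx, m.2.1]
      have hmx : m.1 x ∉ cov g R := by
        rw [← hx]; exact fun h => hxA ((cov_agree hm').2 h)
      apply exists_rep m m' U x hx
      · rw [hU, mem_union, not_or]
        refine ⟨hxA, ?_⟩
        intro h
        obtain ⟨y, hy, rfl⟩ := mem_image.1 h
        rw [m.2.1] at hmx
        exact hmx hy
      · rw [hU, mem_union, not_or]
        refine ⟨hmx, ?_⟩
        intro h
        obtain ⟨y, hy, he⟩ := mem_image.1 h
        rw [m.1.injective he] at hy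
        exact hxA hy
    · intro g' hg' p hp _
      obtain ⟨x, hx, rfl⟩ := mem_image.1 hp
      unfold reps at hx
      simp only [mem_filter, mem_univ, true_and] at hx
      have hxA : x ∉ cov g R := fun h => hx.1 (mem_union_left _ h)
      obtain ⟨h1, h2⟩ := ind_insert hR hg' hxA
      exact hB g' _ h1 h2

lemma down (F : Finset (PMV n)) (hF : ∀ m ∈ F, ∀ m' ∈ F, ∃ i, m.1 i = m'.1 i) (t k : ℕ)
    (hk : k + t = n) (ht : ∀ T, IsCov F T → t ≤ T.card) (d : ℕ) :
    ∀ g R, Ind g R → R.card + d = t → (fam F g R).card ≤ Gf k d := by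
  induction d with
  | zero =>
    intro g R h hd
    exact base F k g R h (by omega)
  | succ d ih =>
    intro g R h hd
    obtain ⟨c, hc, -, hle⟩ := step F hF g R h
      (fun hcov => by
        have := (ht _ hcov).trans card_image_le
        omega) (Gf k d) (fun g' R' h' hc' => ih g' R' h' (by omega))
    refine hle.trans ?_
    rw [Gf]
    apply Nat.mul_le_mul_right
    omega

lemma ind_singleton (g : PMV n) (x) : Ind g {x} := by
  intro i hi
  rw [mem_singleton] at hi ⊢
  subst hi
  exact g.2.2 _

lemma level1 (F : Finset (PMV n)) (hF : ∀ m ∈ F, ∀ m' ∈ F, ∃ i, m.1 i = m'.1 i) (d k : ℕ)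
    (hk : k + (d + 2) = n) (ht : ∀ T, IsCov F T → d + 2 ≤ T.card) (g : PMV n) (x) :
    (fam F g {x}).card ≤ (k + d) * Gf k d := by
  obtain ⟨c, -, hc, hle⟩ := step F hF g {x} (ind_singleton g x)
    (fun hcov => by
      have h1 := (ht _ hcov).trans card_image_le
      rw [card_singleton] at h1
      omega) (Gf k d) (fun g' R' h' hc' => down F hF (d + 2) k hk ht d g' R' h' (by
        simp at hc'; omega))
  refine hle.trans (Nat.mul_le_mul_right _ ?_)
  have := hc (by simp)
  omega

lemma num1 (k d : ℕ) (hk : 1 ≤ k) : (d + 2) * Gf k d ≤ 2 * (2 * (k + d) - 1)‼ := by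
  induction d with
  | zero => simp [Gf]
  | succ d ih =>
    rw [Gf, ← add_assoc k d 1, df_succ]
    have h : (d + 3) * (k + d + 1) ≤ (d + 2) * (2 * (k + d) + 1) := by nlinarith
    calc (d + 1 + 2) * ((k + d + 1) * Gf k d) = ((d + 3) * (k + d + 1)) * Gf k d := by ring
      _ ≤ ((d + 2) * (2 * (k + d) + 1)) * Gf k d := Nat.mul_le_mul_right _ h
      _ = (2 * (k + d) + 1) * ((d + 2) * Gf k d) := by ring
      _ ≤ (2 * (k + d) + 1) * (2 * (2 * (k + d) - 1)‼) := Nat.mul_le_mul_left _ ih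
      _ = _ := by ring

lemma df_pos (k : ℕ) : 0 < k‼ := Nat.doubleFactorial_pos k

lemma num1' (k d : ℕ) (hk : 1 ≤ k) :
    (d + 2) * ((k + d) * Gf k d) < (2 * (k + d + 1) - 1)‼ := by
  rw [df_succ]
  have h := Nat.mul_le_mul_left (k + d) (num1 k d hk)
  have := df_pos (2 * (k + d) - 1)
  nlinarith

lemma num2 (d : ℕ) : (d + 5) * ((d + 3) * Gf 0 (d + 3)) < (2 * (d + 3 + 1) - 1)‼ := by
  induction d with
  | zero => decide
  | succ d ih =>
    rw [df_succ]
    have e : Gf 0 (d + 1 + 3) = (d + 4) * Gf 0 (d + 3) := by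
      show (0 + (d + 3) + 1) * Gf 0 (d + 3) = _
      ring
    rw [e]
    have e2 : d + 1 + 3 = d + 3 + 1 := by ring
    rw [e2]
    have h : (d + 6) * (d + 4) * (d + 4) ≤ (2 * (d + 3 + 1) + 1) * ((d + 5) * (d + 3)) := by
      ring_nf
      nlinarith [Nat.zero_le (d ^ 3), Nat.zero_le (d ^ 2)]
    calc (d + 1 + 5) * ((d + 3 + 1) * ((d + 4) * Gf 0 (d + 3)))
        = ((d + 6) * (d + 4) * (d + 4)) * Gf 0 (d + 3) := by ring
      _ ≤ ((2 * (d + 3 + 1) + 1) * ((d + 5) * (d + 3))) * Gf 0 (d + 3) :=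
        Nat.mul_le_mul_right _ h
      _ = (2 * (d + 3 + 1) + 1) * ((d + 5) * ((d + 3) * Gf 0 (d + 3))) := by ring
      _ < _ := Nat.mul_lt_mul_of_pos_left ih (by omega)

lemma Gf0_pos (d : ℕ) : 1 ≤ Gf 0 d := by
  induction d with
  | zero => decide
  | succ d ih => rw [Gf]; nlinarith

lemma num3 (d : ℕ) (hd : 1 ≤ d) :
    (d + 2) * (d * Gf 0 d - 1) + 1 < (2 * (d + 1) - 1)‼ := by
  rcases d with _ | _ | _ | d
  · omega
  · decide
  · decide
  · have := num2 d
    have h2 := Gf0_pos (d + 3)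
    have h3 : 1 ≤ (d + 3) * Gf 0 (d + 3) := by nlinarith
    have e : d + 1 + 1 + 1 = d + 3 := rfl
    rw [e]
    obtain ⟨q, hq⟩ := Nat.exists_eq_add_of_le h3
    rw [hq] at this ⊢
    rw [Nat.add_sub_cancel_left]
    nlinarith

lemma fam_empty (F : Finset (PMV n)) (g) : fam F g ∅ = F := by
  unfold fam; simp

theorem main (n : ℕ) (F : Finset (PMV n))
    (hF : ∀ m ∈ F, ∀ m' ∈ F, ∃ i, m.1 i = m'.1 i)
    (hcard : F.card = (2 * (n - 1) - 1)‼) :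
    ∃ i j : Fin (2 * n), i ≠ j ∧ ∀ m : PMV n, m ∈ F ↔ m.1 i = j := by
  have hpos : 0 < F.card := by rw [hcard]; exact df_pos _
  obtain ⟨m0, hm0⟩ := card_pos.1 hpos
  -- the cover given by `m0`
  set T0 := (reps m0 ∅).image (fun x => (x, m0.1 x)) with hT0
  have hT0c : IsCov F T0 := by
    intro m hm
    obtain ⟨x, hx⟩ := hF m hm m0 hm0
    exact exists_rep m0 m ∅ x hx (by simp) (by simp)
  have hT0n : T0.card ≤ n := by
    have h1 := card_reps m0 ∅
    refine card_image_le.trans ?_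
    omega
  obtain ⟨T, hT, hmin⟩ : ∃ T, IsCov F T ∧ ∀ T', IsCov F T' → T.card ≤ T'.card := by
    obtain ⟨T, hT, hmin⟩ := Finset.exists_min_image
      (univ.filter (fun T => IsCov F T)) Finset.card ⟨T0, by simpa using hT0c⟩
    refine ⟨T, by simpa using hT, fun T' h => hmin T' (by simpa using h)⟩
  have hTn : T.card ≤ n := (hmin _ hT0c).trans hT0n
  obtain h0 | h1 | ⟨d, hd⟩ : T.card = 0 ∨ T.card = 1 ∨ ∃ d, T.card = d + 2 := by
    rcases h : T.card with _ | _ | d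
    · simp
    · simp
    · right; right; exact ⟨d, rfl⟩
  · obtain ⟨p, hp, _⟩ := hT m0 hm0
    rw [card_eq_zero] at h0
    simp [h0] at hp
  · obtain ⟨⟨i, j⟩, rfl⟩ := card_eq_one.1 h1
    have hij : ∀ m ∈ F, m.1 i = j := by
      intro m hm
      obtain ⟨p, hp, h⟩ := hT m hm
      rw [mem_singleton] at hp
      subst hp
      exact h
    refine ⟨i, j, ?_, ?_⟩
    · rintro rfl
      exact m0.2.2 _ (hij m0 hm0)
    · have hb := base (univ : Finset (PMV n)) (n - 1) m0 {i} (ind_singleton m0 i) (by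
        simp only [card_singleton] at hTn ⊢; omega)
      have hsub : F ⊆ fam univ m0 {i} := by
        intro m hm
        unfold fam
        simp [hij m hm, hij m0 hm0]
      have heq := Finset.eq_of_subset_of_card_le hsub (by rw [hcard]; exact hb)
      intro m
      rw [heq]
      unfold fam
      simp [hij m0 hm0]
  · exfalso
    obtain ⟨k, hk⟩ := Nat.exists_eq_add_of_le hTn
    have hk : k + (d + 2) = n := by omega
    have hmin' : ∀ T, IsCov F T → d + 2 ≤ T.card := fun T' h => by
      rw [← hd]; exact hmin T' h
    have L := level1 F hF d k hk hmin'
    have hn1 : n - 1 = k + d + 1 := by omega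
    rw [hn1] at hcard
    rcases Nat.eq_zero_or_pos k with rfl | hkpos
    · rcases Nat.eq_zero_or_pos d with rfl | hdpos
      · -- n = 2
        have hx := L m0 (⟨0, by omega⟩)
        have : m0 ∈ fam F m0 {(⟨0, by omega⟩ : Fin (2 * n))} := by
          unfold fam; simp [hm0]
        have := card_pos.2 ⟨_, this⟩
        omega
      · have hb := branch (F.erase m0) m0 ∅ T0 (d * Gf 0 d - 1) ?_ ?_
        · rw [fam_empty, card_erase_of_mem hm0] at hb
          have h3 := num3 d hdpos
          have h4 : T0.card * (d * Gf 0 d - 1) ≤ (d + 2) * (d * Gf 0 d - 1) :=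
            Nat.mul_le_mul_right _ (by omega)
          simp only [zero_add] at hcard
          omega
        · intro m hm
          rw [fam_empty] at hm
          exact hT0c m (mem_of_mem_erase hm)
        · intro g' hg' p hp hpe
          obtain ⟨x, hx, rfl⟩ := mem_image.1 hp
          simp only at hpe ⊢
          have hL := L g' x
          have hmem : m0 ∈ fam F g' {x} := by
            unfold fam; simp [hm0, hpe]
          have hsub : fam (F.erase m0) g' (insert x ∅) ⊆ (fam F g' {x}).erase m0 := by
            intro m hm
            unfold fam at hm ⊢
            simp at hm ⊢
            tauto
          have := card_le_card hsub
          rw [card_erase_of_mem hmem] at this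
          simp only [zero_add] at hL
          omega
    · have hb := branch F m0 ∅ T ((k + d) * Gf k d) ?_ ?_
      · rw [fam_empty, hd] at hb
        have := num1' k d hkpos
        omega
      · intro m hm
        rw [fam_empty] at hm
        exact hT m hm
      · intro g' _ p _ _
        exact L g' p.1

end EKRProof

/-- Uniqueness in the Erdős–Ko–Rado theorem for perfect matchings: an intersecting
family of perfect matchings of `K_{2n}` of the maximum size `(2(n-1)-1)!!` consists of
all the perfect matchings containing some fixed edge `{i,j}`. -/
theorem EKR_matchings_uniqueness (n : ℕ) (hn : 1 ≤ n) (F : Finset (PMV n))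
    (hF : ∀ m ∈ F, ∀ m' ∈ F, ∃ i, m.1 i = m'.1 i)
    (hcard : F.card = (2 * (n - 1) - 1)‼) :
    ∃ i j : Fin (2 * n), i ≠ j ∧ ∀ m : PMV n, m ∈ F ↔ m.1 i = j := by
  exact EKRProof.main n F hF hcard
end

section
/- In a symmetric association scheme on n points, if Γ is a union of some of the non-identity relation graphs, C is a clique of Γ, and S is an independent set of Γ, then |C|·|S| ≤ n. -/
open Matrix Polynomial in
theorem trace_aeval_aux {V : Type} [Fintype V] [DecidableEq V] (M : Matrix V V ℝ)
    (hM : M.IsHermitian) (p : ℝ[X]) :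
    (aeval M p).trace = ∑ i, p.eval (hM.eigenvalues i) := by
  conv_lhs => rw [hM.spectral_theorem]
  rw [aeval_algHom_apply, Unitary.conjStarAlgAut_apply, Matrix.trace_mul_cycle]
  have : (diagonal (RCLike.ofReal ∘ hM.eigenvalues) : Matrix V V ℝ)
    = diagonalAlgHom ℝ (hM.eigenvalues) := by
    rfl
  rw [this, aeval_algHom_apply]
  have h2 : ∀ d : V → ℝ, diagonalAlgHom ℝ d = diagonal d := fun _ => rfl
  rw [h2]
  simp [Matrix.trace_diagonal, aeval_fn_apply]

open Matrix Polynomial in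
theorem psd_of_trace_aux {V : Type} [Fintype V] [DecidableEq V] (M : Matrix V V ℝ)
    (hM : M.IsHermitian) (h : ∀ p : ℝ[X], 0 ≤ (M * (aeval M p * aeval M p)).trace) :
    M.PosSemidef := by
  rw [hM.posSemidef_iff_eigenvalues_nonneg]
  intro i
  let E := (Finset.univ.image hM.eigenvalues).erase (hM.eigenvalues i)
  let p : ℝ[X] := ∏ μ ∈ E, (X - C μ)
  have h1 := h p
  have e : M * (aeval M p * aeval M p) = aeval M (X * (p * p)) := by simp
  rw [e, trace_aeval_aux M hM] at h1
  have hpi : p.eval (hM.eigenvalues i) ≠ 0 := by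
    simp only [p, eval_prod, Finset.prod_ne_zero_iff]
    intro μ hμ
    have := Finset.ne_of_mem_erase hμ
    simpa [sub_eq_zero] using this.symm
  have hp0 : ∀ j, hM.eigenvalues j ≠ hM.eigenvalues i → p.eval (hM.eigenvalues j) = 0 := by
    intro j hj
    simp only [p, eval_prod]
    apply Finset.prod_eq_zero (i := hM.eigenvalues j)
    · simp [E, hj]
    · simp
  by_contra hneg
  simp only [Pi.zero_apply, not_le] at hneg
  apply absurd h1
  rw [not_le]
  apply Finset.sum_neg' 
  · intro j _
    by_cases hj : hM.eigenvalues j = hM.eigenvalues i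
    · rw [hj]; simp only [eval_mul, eval_X]
      exact mul_nonpos_of_nonpos_of_nonneg hneg.le (mul_self_nonneg _)
    · simp [hp0 j hj]
  · refine ⟨i, Finset.mem_univ _, ?_⟩
    simp only [eval_mul, eval_X]
    exact mul_neg_of_neg_of_pos hneg (mul_self_pos.mpr hpi)

open Matrix Polynomial in
theorem key_aux {V : Type} [Fintype V] [DecidableEq V] [Nonempty V]
    (T : Subalgebra ℝ (Matrix V V ℝ)) (hsymm : ∀ B ∈ T, Bᵀ = B)
    (J : Matrix V V ℝ) (hJ : J = Matrix.of fun _ _ => 1) (hJT : J ∈ T)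
    (hJc : ∀ B ∈ T, B * J = J * B) (s : V → ℝ) (M : Matrix V V ℝ) (hMT : M ∈ T)
    (hM : ∀ B ∈ T, (M * B).trace = s ⬝ᵥ (B *ᵥ s)) (c : V → ℝ) :
    (∑ v, s v) ^ 2 / (Fintype.card V : ℝ) ^ 2 * (∑ v, c v) ^ 2 ≤ c ⬝ᵥ (M *ᵥ c) := by
  have hn : (0 : ℝ) < Fintype.card V := by exact_mod_cast Fintype.card_pos
  set n : ℝ := ((Fintype.card V : ℕ) : ℝ) with hndef
  set σ := ∑ v, s v with hσ
  let t := σ ^ 2 / n ^ 2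
  have hM'T : M - t • J ∈ T := T.sub_mem hMT (T.smul_mem hJT t)
  have hpos : (M - t • J).PosSemidef := by
    apply psd_of_trace_aux
    · rw [Matrix.IsHermitian, Matrix.conjTranspose_eq_transpose_of_trivial]; exact hsymm _ hM'T
    intro p
    have hB : aeval (M - t • J) p ∈ T := by
      rw [← coe_aeval_mk_apply (h := hM'T)]; exact Subtype.property _
    generalize aeval (M - t • J) p = B at hB
    have hBs := hsymm B hB
    obtain ⟨v0⟩ := ‹Nonempty V›
    have hsw : ∀ u v, B u v = B v u := fun u v => congrFun (congrFun hBs v) u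
    obtain ⟨r, hr⟩ : ∃ r, ∀ u, ∑ v, B u v = r := by
      refine ⟨∑ v, B v v0, fun u => ?_⟩
      have := congrFun (congrFun (hJc B hB) u) v0
      simpa [hJ, Matrix.mul_apply] using this
    have hr' : ∀ v, ∑ u, B u v = r := fun v => by rw [← hr v]; simp_rw [hsw v]
    have e1 : (M * (B * B)).trace = ∑ u, (B *ᵥ s) u ^ 2 := by
      rw [hM _ (T.mul_mem hB hB), ← Matrix.mulVec_mulVec, Matrix.dotProduct_mulVec,
        ← Matrix.mulVec_transpose, hBs]
      simp [dotProduct, sq]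
    have e2 : (J * (B * B)).trace = r ^ 2 * n := by
      have : J * B = r • J := by ext u v; simp [hJ, Matrix.mul_apply, hr']
      rw [← mul_assoc, this, smul_mul_assoc, this]
      simp [hJ, Matrix.trace, ← hndef]; ring
    have e3 : ∑ u, (B *ᵥ s) u = r * σ := by
      simp only [Matrix.mulVec, dotProduct]
      rw [Finset.sum_comm]
      simp_rw [← Finset.sum_mul, hr', ← Finset.mul_sum]; rfl
    have cs := sq_sum_le_card_mul_sum_sq (s := Finset.univ) (f := fun u => (B *ᵥ s) u)
    rw [e3, Finset.card_univ, ← hndef] at cs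
    rw [sub_mul, smul_mul_assoc, Matrix.trace_sub, Matrix.trace_smul, e1, e2, smul_eq_mul]
    have : t * (r ^ 2 * n) = (r * σ) ^ 2 / n := by simp only [t]; field_simp
    rw [this, sub_nonneg, div_le_iff₀ hn]; linarith
  have := hpos.dotProduct_mulVec_nonneg c
  rw [Matrix.sub_mulVec, Matrix.smul_mulVec, dotProduct_sub, dotProduct_smul] at this
  have e : c ⬝ᵥ (J *ᵥ c) = (∑ v, c v) ^ 2 := by
    simp [hJ, Matrix.mulVec, dotProduct, ← Finset.sum_mul, sq]
  simp only [star_trivial] at this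
  rw [e, smul_eq_mul] at this
  simp only [t] at this
  linarith

/-- The Delsarte clique–coclique bound: in a symmetric association scheme
`A_0 = I, A_1, …, A_m` on a finite point set `V`, if `Γ` is the union of the relation
graphs `A_i` for `i` in a set `Λ` of non-identity indices, `C` is a clique of `Γ` and
`S` is an independent set of `Γ`, then `|C| * |S| ≤ |V|`. -/
theorem clique_coclique_bound {V : Type} [Fintype V] [DecidableEq V] {m : ℕ}
    (A : Fin (m + 1) → Matrix V V ℕ)
    (h01 : ∀ i u v, A i u v = 0 ∨ A i u v = 1)
    (hsym : ∀ i, (A i).IsSymm)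
    (hid : A 0 = 1)
    (hsum : ∑ i, A i = Matrix.of fun _ _ => 1)
    (hmul : ∀ i j, ∃ p : Fin (m + 1) → ℕ, A i * A j = ∑ k, p k • A k)
    (hcomm : ∀ i j, A i * A j = A j * A i)
    (Λ : Finset (Fin (m + 1))) (hΛ : (0 : Fin (m + 1)) ∉ Λ)
    (C S : Finset V)
    (hC : ∀ u ∈ C, ∀ v ∈ C, u ≠ v → ∃ i ∈ Λ, A i u v = 1)
    (hS : ∀ u ∈ S, ∀ v ∈ S, u ≠ v → ∀ i ∈ Λ, A i u v = 0) :
    C.card * S.card ≤ Fintype.card V := by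
  classical
  rcases isEmpty_or_nonempty V with hV | hV
  · simp [Finset.eq_empty_of_isEmpty]
  let R : Fin (m + 1) → Matrix V V ℝ := fun i => (A i).map (Nat.castRingHom ℝ)
  have hR : ∀ i u v, R i u v = (A i u v : ℝ) := fun i u v => rfl
  have hRmul : ∀ i j, R i * R j = (A i * A j).map (Nat.castRingHom ℝ) :=
    fun i j => (Matrix.map_mul (f := Nat.castRingHom ℝ)).symm
  have hsum1 : ∀ u v, ∑ i, A i u v = 1 := fun u v => by
    have := congrFun (congrFun hsum u) v
    simpa [Matrix.sum_apply] using this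
  -- disjointness
  have hdisj : ∀ i j u v, i ≠ j → A i u v = 1 → A j u v = 0 := by
    intro i j u v hij h1
    have h2 := hsum1 u v
    rw [← Finset.add_sum_erase _ _ (Finset.mem_univ i), h1] at h2
    have h3 : ∑ x ∈ Finset.univ.erase i, A x u v = 0 := by omega
    exact Finset.sum_eq_zero_iff.mp h3 j (by simp [hij.symm])
  let P := Submodule.span ℝ (Set.range R)
  have hRP : ∀ i, R i ∈ P := fun i => Submodule.subset_span ⟨i, rfl⟩
  have h1P : (1 : Matrix V V ℝ) ∈ P := by
    have : R 0 = 1 := by simp [R, hid]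
    rw [← this]; exact hRP 0
  have hmulP : ∀ x y, x ∈ P → y ∈ P → x * y ∈ P := by
    intro x y hx hy
    have h : P * P ≤ P := by
      rw [Submodule.span_mul_span]
      apply Submodule.span_le.mpr
      rintro _ ⟨_, ⟨i, rfl⟩, _, ⟨j, rfl⟩, rfl⟩
      obtain ⟨p, hp⟩ := hmul i j
      have : R i * R j = ∑ k, (p k : ℝ) • R k := by
        rw [hRmul, hp]; ext u v
        simp only [Matrix.sum_apply, hR, Matrix.map_apply, Matrix.smul_apply, smul_eq_mul,
          Nat.coe_castRingHom, Nat.cast_sum, Nat.cast_mul]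
      simp only [this]
      exact P.sum_mem fun k _ => P.smul_mem _ (hRP k)
    exact h (Submodule.mul_mem_mul hx hy)
  let T := P.toSubalgebra h1P hmulP
  have hTP : ∀ B, B ∈ T ↔ B ∈ P := fun B => Iff.rfl
  let J : Matrix V V ℝ := Matrix.of fun _ _ => 1
  have hJsum : J = ∑ i, R i := by
    ext u v
    simp only [J, Matrix.sum_apply, hR, Matrix.of_apply]
    exact_mod_cast (hsum1 u v).symm
  have hJT : J ∈ T := by
    rw [hTP, hJsum]; exact P.sum_mem fun k _ => hRP k
  have hsymm : ∀ B ∈ T, B.transpose = B := by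
    intro B hB
    refine Submodule.span_induction ?_ ?_ ?_ ?_ ((hTP B).1 hB)
    · rintro _ ⟨i, rfl⟩; ext u v; simp [hR, (hsym i).apply]
    · simp
    · intro x y _ _ hx hy; simp [hx, hy]
    · intro a x _ hx; simp [hx]
  have hJc : ∀ B ∈ T, B * J = J * B := by
    intro B hB
    refine Submodule.span_induction ?_ ?_ ?_ ?_ ((hTP B).1 hB)
    · rintro _ ⟨i, rfl⟩
      rw [hJsum, Finset.mul_sum, Finset.sum_mul]
      exact Finset.sum_congr rfl fun j _ => by rw [hRmul, hRmul, hcomm]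
    · simp
    · intro x y _ _ hx hy; simp [add_mul, mul_add, hx, hy]
    · intro a x _ hx; simp [hx]
  let ind : Finset V → V → ℝ := fun D v => if v ∈ D then 1 else 0
  let q : (V → ℝ) → Fin (m + 1) → ℝ := fun x i => dotProduct x ((R i).mulVec x)
  have hq : ∀ D i, q (ind D) i = ∑ u ∈ D, ∑ v ∈ D, (A i u v : ℝ) := by
    intro D i
    simp [q, ind, dotProduct, Matrix.mulVec, hR]
  let w : Fin (m + 1) → ℝ := fun i => ∑ u, ∑ v, (A i u v : ℝ)
  let s := ind S
  let c := ind C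
  let M : Matrix V V ℝ := ∑ i, (q s i / w i) • R i
  have hMT : M ∈ T := (hTP _).2 (P.sum_mem fun k _ => P.smul_mem _ (hRP k))
  have htr : ∀ i j, (R i * R j).trace = if i = j then w i else 0 := by
    intro i j
    have : (R i * R j).trace = ∑ u, ∑ v, (A i u v : ℝ) * A j u v := by
      simp only [Matrix.trace, Matrix.diag, Matrix.mul_apply, hR]
      refine Finset.sum_congr rfl fun u _ => Finset.sum_congr rfl fun v _ => ?_
      rw [(hsym j).apply]
    rw [this]
    split_ifs with hij
    · subst hij
      refine Finset.sum_congr rfl fun u _ => Finset.sum_congr rfl fun v _ => ?_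
      rcases h01 i u v with h | h <;> simp [h]
    · refine Finset.sum_eq_zero fun u _ => Finset.sum_eq_zero fun v _ => ?_
      rcases h01 i u v with h | h
      · simp [h]
      · simp [hdisj i j u v hij h]
  have hw0 : ∀ i, w i = 0 → R i = 0 := by
    intro i hi
    have h' : ∑ u, ∑ v, A i u v = 0 := by
      simp only [w] at hi
      exact_mod_cast hi
    ext u v
    have h2 := Finset.sum_eq_zero_iff.mp h' u (Finset.mem_univ _)
    have h3 := Finset.sum_eq_zero_iff.mp h2 v (Finset.mem_univ _)
    simp [hR, h3]
  have hM : ∀ B ∈ T, (M * B).trace = dotProduct s (B.mulVec s) := by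
    intro B hB
    refine Submodule.span_induction ?_ ?_ ?_ ?_ ((hTP B).1 hB)
    · rintro _ ⟨j, rfl⟩
      have : (M * R j).trace = q s j / w j * w j := by
        simp [M, Finset.sum_mul, Matrix.trace_sum, htr]
      rw [this]
      by_cases hj : w j = 0
      · simp [hj, hw0 j hj]
      · rw [div_mul_cancel₀ _ hj]
    · simp
    · intro x y _ _ hx hy
      rw [mul_add, Matrix.trace_add, hx, hy, Matrix.add_mulVec, dotProduct_add]
    · intro a x _ hx
      rw [mul_smul_comm, Matrix.trace_smul, hx, Matrix.smul_mulVec, dotProduct_smul]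
  have key := key_aux T hsymm J rfl hJT hJc s M hMT hM c
  have hcM : dotProduct c (M.mulVec c) = ∑ i, q s i / w i * q c i := by
    simp [M, q, Matrix.sum_mulVec, dotProduct_sum, Matrix.smul_mulVec, dotProduct_smul]
  have h0 : ∀ D : Finset V, q (ind D) 0 = D.card := by
    intro D
    rw [hq, hid]; simp [Matrix.one_apply]
  have hw : w 0 = Fintype.card V := by
    simp [w, hid, Matrix.one_apply]
  have hdiag : ∀ i u, i ≠ 0 → A i u u = 0 := fun i u hi =>
    hdisj 0 i u u hi.symm (by simp [hid])
  have hrest : ∀ i, i ≠ 0 → q s i / w i * q c i = 0 := by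
    intro i hi
    by_cases hiΛ : i ∈ Λ
    · have : q s i = 0 := by
        rw [hq]
        refine Finset.sum_eq_zero fun u hu => Finset.sum_eq_zero fun v hv => ?_
        by_cases huv : u = v
        · subst huv; simp [hdiag i u hi]
        · simp [hS u hu v hv huv i hiΛ]
      simp [this]
    · have : q c i = 0 := by
        rw [hq]
        refine Finset.sum_eq_zero fun u hu => Finset.sum_eq_zero fun v hv => ?_
        by_cases huv : u = v
        · subst huv; simp [hdiag i u hi]
        · obtain ⟨j, hj, hj1⟩ := hC u hu v hv huv
          simp [hdisj j i u v (fun h => hiΛ (h ▸ hj)) hj1]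
      simp [this]
  rw [hcM, Finset.sum_eq_single 0 (fun i _ hi => hrest i hi) (by simp), h0, h0, hw] at key
  have hs : ∑ v, s v = S.card := by simp [s, ind]
  have hc : ∑ v, c v = C.card := by simp [c, ind]
  rw [hs, hc] at key
  have hn : (0 : ℝ) < Fintype.card V := by exact_mod_cast Fintype.card_pos
  by_contra hlt
  rw [not_le] at hlt
  have hlt' : (Fintype.card V : ℝ) < C.card * S.card := by exact_mod_cast hlt
  have e1 : (S.card : ℝ) ^ 2 / (Fintype.card V : ℝ) ^ 2 * (C.card : ℝ) ^ 2
      = ((C.card : ℝ) * S.card) ^ 2 / (Fintype.card V : ℝ) ^ 2 := by ring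
  have e2 : (S.card : ℝ) / Fintype.card V * C.card
      = ((C.card : ℝ) * S.card) * Fintype.card V / (Fintype.card V : ℝ) ^ 2 := by
    field_simp
  rw [e1, e2, div_le_div_iff_of_pos_right (by positivity)] at key
  nlinarith
end

section
/- If F is a family of perfect matchings of K_{2n} such that for any m, m' ∈ F the union multigraph m ∪ m' is not a single cycle of length 2n (i.e., F is non-Hamiltonian), then |F| ≤ (2(n-1)-1)!!, and this bound is attained by any family of all matchings through a fixed edge. -/
open scoped Nat Classical

set_option linter.unusedSectionVars false

namespace NH

open Equiv Finset

section
variable {α : Type} [Fintype α] [DecidableEq α]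

/-- Perfect matchings of the finite set `S`, as involutions of the ambient type. -/
def MM (S : Finset α) : Finset (Perm α) :=
  univ.filter fun m => (∀ v, m (m v) = v) ∧ ∀ v, m v ≠ v ↔ v ∈ S

lemma mem_MM {S : Finset α} {m : Perm α} :
    m ∈ MM S ↔ (∀ v, m (m v) = v) ∧ ∀ v, m v ≠ v ↔ v ∈ S := by
  simp [MM]

lemma MM_inv {S : Finset α} {m : Perm α} (h : m ∈ MM S) (v : α) : m (m v) = v :=
  (mem_MM.1 h).1 v

lemma MM_ne {S : Finset α} {m : Perm α} (h : m ∈ MM S) {v : α} (hv : v ∈ S) : m v ≠ v :=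
  ((mem_MM.1 h).2 v).2 hv

lemma MM_fix {S : Finset α} {m : Perm α} (h : m ∈ MM S) {v : α} (hv : v ∉ S) : m v = v := by
  by_contra h'
  exact hv (((mem_MM.1 h).2 v).1 h')

lemma MM_mem {S : Finset α} {m : Perm α} (h : m ∈ MM S) {v : α} (hv : v ∈ S) : m v ∈ S := by
  apply ((mem_MM.1 h).2 _).1
  rw [MM_inv h]
  exact (MM_ne h hv).symm

lemma MM_eq_iff {S : Finset α} {m : Perm α} (h : m ∈ MM S) (v w : α) : m v = w ↔ m w = v := by
  constructor
  · rintro rfl; exact MM_inv h v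
  · rintro rfl; exact MM_inv h w

lemma MM_add {S : Finset α} {y z : α} (hy : y ∈ S) (hz : z ∈ S.erase y) {m : Perm α}
    (h : m ∈ MM ((S.erase y).erase z)) : m * swap z y ∈ MM S ∧ (m * swap z y) y = z := by
  have hzy : z ≠ y := (Finset.mem_erase.1 hz).1
  have hzS : z ∈ S := (Finset.mem_erase.1 hz).2
  have my : m y = y := MM_fix h (by simp)
  have mz : m z = z := MM_fix h (by simp)
  have inv := MM_inv h
  refine ⟨mem_MM.2 ⟨?_, ?_⟩, by simp [mz]⟩
  · intro v
    by_cases h1 : v = y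
    · subst h1; simp [mz, my]
    by_cases h2 : v = z
    · subst h2; simp [mz, my]
    have h3 : m v ≠ y := fun hh => h1 (by rw [← inv v, hh, my])
    have h4 : m v ≠ z := fun hh => h2 (by rw [← inv v, hh, mz])
    simp [swap_apply_of_ne_of_ne h2 h1, swap_apply_of_ne_of_ne h4 h3, inv]
  · intro v
    by_cases h1 : v = y
    · subst h1; simp [mz, hzy, hy]
    by_cases h2 : v = z
    · subst h2; simp [my, hzS, Ne.symm hzy]
    have := (mem_MM.1 h).2 v
    simp [swap_apply_of_ne_of_ne h2 h1]
    simpa [h1, h2] using this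

lemma MM_del {S : Finset α} {y z : α} (hy : y ∈ S) (hz : z ∈ S.erase y) {m : Perm α}
    (h : m ∈ MM S) (hm : m y = z) : m * swap z y ∈ MM ((S.erase y).erase z) := by
  have hzy : z ≠ y := (Finset.mem_erase.1 hz).1
  have hzS : z ∈ S := (Finset.mem_erase.1 hz).2
  have mz : m z = y := (MM_eq_iff h _ _).1 hm
  have inv := MM_inv h
  refine mem_MM.2 ⟨?_, ?_⟩
  · intro v
    by_cases h1 : v = y
    · subst h1; simp [mz]
    by_cases h2 : v = z
    · subst h2; simp [hm]
    have h3 : m v ≠ y := fun hh => h2 (by rw [← inv v, hh, hm])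
    have h4 : m v ≠ z := fun hh => h1 (by rw [← inv v, hh, mz])
    simp [swap_apply_of_ne_of_ne h2 h1, swap_apply_of_ne_of_ne h4 h3, inv]
  · intro v
    by_cases h1 : v = y
    · subst h1; simp [mz]
    by_cases h2 : v = z
    · subst h2; simp [hm]
    have := (mem_MM.1 h).2 v
    simp [swap_apply_of_ne_of_ne h2 h1, h1, h2]
    simpa using this

lemma sum_edge {S : Finset α} {y z : α} (hy : y ∈ S) (hz : z ∈ S.erase y) (F : Perm α → ℝ) :
    ∑ m ∈ MM S, (if m y = z then F m else 0)
      = ∑ m ∈ MM ((S.erase y).erase z), F (m * swap z y) := by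
  rw [← Finset.sum_filter]
  refine Finset.sum_nbij' (fun m => m * swap z y) (fun m => m * swap z y) ?_ ?_ ?_ ?_ ?_
  · intro m hm
    rw [Finset.mem_filter] at hm
    exact MM_del hy hz hm.1 hm.2
  · intro m hm
    rw [Finset.mem_filter]
    exact MM_add hy hz hm
  · intro m _; simp [mul_assoc]
  · intro m _; simp [mul_assoc]
  · intro m _; simp [mul_assoc]

lemma sum_vertex {S : Finset α} {x : α} (hx : x ∈ S) (F : Perm α → ℝ) :
    ∑ m ∈ MM S, F m
      = ∑ a ∈ S.erase x, ∑ m ∈ MM ((S.erase x).erase a), F (m * swap a x) := by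
  have : ∀ m ∈ MM S, F m = ∑ a ∈ S.erase x, if m x = a then F m else 0 := by
    intro m hm
    rw [Finset.sum_ite_eq, if_pos]
    exact Finset.mem_erase.2 ⟨MM_ne hm hx, MM_mem hm hx⟩
  rw [Finset.sum_congr rfl this, Finset.sum_comm]
  exact Finset.sum_congr rfl fun a ha => sum_edge hx ha F

/-- Number of perfect matchings of a `2k`-set. -/
def mu : ℕ → ℝ
  | 0 => 1
  | (k + 1) => (2 * k + 1) * mu k

lemma mu_pos (k : ℕ) : 0 < mu k := by
  induction k with
  | zero => simp [mu]
  | succ k ih => simp only [mu]; positivity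

lemma card_MM (k : ℕ) : ∀ (S : Finset α), S.card = 2 * k → ∑ _m ∈ MM S, (1 : ℝ) = mu k := by
  induction k with
  | zero =>
    intro S hS
    have hS : S = ∅ := by simpa using hS
    subst hS
    have : MM (∅ : Finset α) = {1} := by
      ext m
      rw [mem_MM]
      simp only [Finset.notMem_empty, iff_false, not_not, Finset.mem_singleton]
      constructor
      · rintro ⟨_, h⟩; ext v; simp [h v]
      · rintro rfl; simp
    simp [this, mu]
  | succ k ih =>
    intro S hS
    obtain ⟨x, hx⟩ : S.Nonempty := Finset.card_pos.1 (by omega)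
    rw [sum_vertex hx]
    have : ∀ a ∈ S.erase x, ∑ _m ∈ MM ((S.erase x).erase a), (1 : ℝ) = mu k := by
      intro a ha
      apply ih
      rw [Finset.card_erase_of_mem ha, Finset.card_erase_of_mem hx]; omega
    rw [Finset.sum_congr rfl this]
    simp only [Finset.sum_const, Finset.card_erase_of_mem hx, hS, mu, nsmul_eq_mul]
    rw [show 2 * (k + 1) - 1 = 2 * k + 1 by omega]
    push_cast; ring

/-- conjugation by a transposition -/
def cj (a b : α) (m : Perm α) : Perm α := swap a b * m * swap a b

lemma cj_cj (a b : α) (m : Perm α) : cj a b (cj a b m) = m := by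
  simp [cj, mul_assoc]

lemma cj_comm (a b : α) (m : Perm α) : cj a b m = cj b a m := by
  simp [cj, swap_comm a b]

lemma cj_mem {S : Finset α} {a b : α} (ha : a ∈ S) (hb : b ∈ S) {m : Perm α}
    (h : m ∈ MM (S.erase a)) : cj a b m ∈ MM (S.erase b) := by
  refine mem_MM.2 ⟨?_, ?_⟩
  · intro v; simp [cj, MM_inv h]
  · intro v
    have h2 := (mem_MM.1 h).2 (swap a b v)
    have h3 : cj a b m v ≠ v ↔ m (swap a b v) ≠ swap a b v := by
      simp only [cj, Perm.mul_apply, ne_eq, not_iff_not]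
      constructor
      · intro h; exact swap_apply_eq_iff.1 h
      · intro h; rw [h]; simp
    rw [h3, h2]
    by_cases h1 : v = a
    · subst h1
      simp only [swap_apply_left, Finset.mem_erase, ha, hb]
      simp [eq_comm]
    by_cases h4 : v = b
    · subst h4; simp
    rw [swap_apply_of_ne_of_ne h1 h4]; simp [h1, h4]

lemma sum_cj {S : Finset α} {a b : α} (ha : a ∈ S) (hb : b ∈ S) (F : Perm α → ℝ) :
    ∑ m ∈ MM (S.erase a), F (cj a b m) = ∑ m ∈ MM (S.erase b), F m := by
  refine Finset.sum_nbij' (cj a b) (cj a b) ?_ ?_ ?_ ?_ ?_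
  · intro m hm; exact cj_mem ha hb hm
  · intro m hm; rw [cj_comm]; exact cj_mem hb ha hm
  · intro m _; exact cj_cj _ _ _
  · intro m _; exact cj_cj _ _ _
  · intro m _; rfl

lemma cj_mul_swap {a b y z : α} (h1 : y ≠ a) (h2 : y ≠ b) (h3 : z ≠ a) (h4 : z ≠ b)
    (m : Perm α) : cj a b (m * swap z y) = cj a b m * swap z y := by
  have : swap z y * swap a b = swap a b * swap z y := by
    ext v
    simp only [Perm.mul_apply]
    simp only [swap_apply_def]
    grind
  simp only [cj, mul_assoc, this]

end

section
variable {α : Type} [DecidableEq α]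

lemma triple_bad (S : Finset α) (X : α → α → α → ℝ) (h0 : ∀ a v w, 0 ≤ X a v w)
    (h1 : ∀ a, X a a a = 0) :
    ∑ a ∈ S, ∑ w ∈ S, X a a w + ∑ a ∈ S, ∑ v ∈ S, X a v a + ∑ a ∈ S, ∑ v ∈ S, X a v v
      ≤ ∑ a ∈ S, ∑ v ∈ S, ∑ w ∈ S, X a v w := by
  have e1 : ∑ a ∈ S, ∑ w ∈ S, X a a w
      = ∑ a ∈ S, ∑ v ∈ S, ∑ w ∈ S, (if a = v then X a v w else 0) := by
    refine Finset.sum_congr rfl fun a ha => ?_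
    rw [Finset.sum_comm]
    refine Finset.sum_congr rfl fun w _ => ?_
    rw [Finset.sum_ite_eq, if_pos ha]
  have e2 : ∑ a ∈ S, ∑ v ∈ S, X a v a
      = ∑ a ∈ S, ∑ v ∈ S, ∑ w ∈ S, (if a = w then X a v w else 0) := by
    refine Finset.sum_congr rfl fun a ha => Finset.sum_congr rfl fun v _ => ?_
    rw [Finset.sum_ite_eq, if_pos ha]
  have e3 : ∑ a ∈ S, ∑ v ∈ S, X a v v
      = ∑ a ∈ S, ∑ v ∈ S, ∑ w ∈ S, (if v = w then X a v w else 0) := by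
    refine Finset.sum_congr rfl fun a ha => Finset.sum_congr rfl fun v hv => ?_
    rw [Finset.sum_ite_eq, if_pos hv]
  rw [e1, e2, e3]
  simp only [← Finset.sum_add_distrib]
  refine Finset.sum_le_sum fun a _ => Finset.sum_le_sum fun v _ => Finset.sum_le_sum fun w _ => ?_
  have := h0 a v w
  have := h1 a
  by_cases h : a = v <;> by_cases h' : a = w <;> by_cases h'' : v = w <;> simp_all

/-- The inequality on arrays of weighted graphs with zero vertex sums. -/
lemma array_ineq (S : Finset α) (N : ℝ) (hN : (S.card : ℝ) = N) (hN5 : 5 ≤ N)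
    (ph : α → α → α → ℝ)
    (hs : ∀ a v w, ph a v w = ph a w v) (hd : ∀ a v, ph a v v = 0)
    (h0 : ∀ a w, ph a a w = 0) (hz : ∀ a v, ∑ w ∈ S, ph a v w = 0) :
    ∑ v ∈ S, ∑ w ∈ S, (∑ a ∈ S, ph a v w) ^ 2
      ≤ (N - 2 - 2 / (N - 3)) * ∑ a ∈ S, ∑ v ∈ S, ∑ w ∈ S, ph a v w ^ 2 := by
  set P : α → α → ℝ := fun v w => ∑ a ∈ S, ph a v w with hP
  have Ps : ∀ v w, P v w = P w v := fun v w => Finset.sum_congr rfl fun a _ => hs a v w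
  have Pd : ∀ v, P v v = 0 := fun v => Finset.sum_eq_zero fun a _ => hd a v
  have Pz : ∀ v, ∑ w ∈ S, P v w = 0 := by
    intro v
    simp only [hP]
    rw [Finset.sum_comm]
    exact Finset.sum_eq_zero fun a _ => hz a v
  have Pz' : ∀ v, ∑ w ∈ S, P w v = 0 := by
    intro v; rw [← Pz v]; exact Finset.sum_congr rfl fun w _ => Ps w v
  obtain ⟨q, hq⟩ : ∃ q : ℝ, q = 1 / (N - 3) := ⟨_, rfl⟩
  have hq1 : q * (N - 3) = 1 := by rw [hq]; field_simp [show N - 3 ≠ 0 by linarith]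
  have hq0 : 0 < q := by rw [hq]; apply div_pos one_pos; linarith
  have hq2 : 2 / (N - 3) = 2 * q := by rw [hq]; ring
  rw [hq2]
  set c := N - 2 - 2 * q with hc
  have hc0 : 0 < c := by nlinarith
  set T := ∑ v ∈ S, ∑ w ∈ S, P v w ^ 2 with hT
  set R := ∑ a ∈ S, ∑ v ∈ S, ∑ w ∈ S, ph a v w ^ 2 with hR
  have hTs : ∑ v ∈ S, ∑ w ∈ S, P w v ^ 2 = T := by
    rw [hT]; exact Finset.sum_congr rfl fun v _ => Finset.sum_congr rfl fun w _ => by rw [Ps]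
  have key := triple_bad S (fun a v w => (c * ph a v w - (P v w + q * (P a v + P a w))) ^ 2)
    (fun a v w => sq_nonneg _) (fun a => by simp [h0, Pd])
  -- bad terms
  have b1 : ∑ a ∈ S, ∑ w ∈ S, (c * ph a a w - (P a w + q * (P a a + P a w))) ^ 2
      = (1 + q) ^ 2 * T := by
    rw [hT, Finset.mul_sum]
    refine Finset.sum_congr rfl fun a _ => ?_
    rw [Finset.mul_sum]
    refine Finset.sum_congr rfl fun w _ => ?_
    rw [h0, Pd]; ring
  have b2 : ∑ a ∈ S, ∑ v ∈ S, (c * ph a v a - (P v a + q * (P a v + P a a))) ^ 2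
      = (1 + q) ^ 2 * T := by
    rw [hT, Finset.mul_sum]
    refine Finset.sum_congr rfl fun a _ => ?_
    rw [Finset.mul_sum]
    refine Finset.sum_congr rfl fun w _ => ?_
    rw [hs, h0, Pd, Ps w a]; ring
  have b3 : ∑ a ∈ S, ∑ v ∈ S, (c * ph a v v - (P v v + q * (P a v + P a v))) ^ 2
      = 4 * q ^ 2 * T := by
    rw [hT, Finset.mul_sum]
    refine Finset.sum_congr rfl fun a _ => ?_
    rw [Finset.mul_sum]
    refine Finset.sum_congr rfl fun w _ => ?_
    rw [hd, Pd]; ring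
  -- the main sum
  have e : ∀ a v w, (c * ph a v w - (P v w + q * (P a v + P a w))) ^ 2
      = c ^ 2 * ph a v w ^ 2 - 2 * c * (ph a v w * P v w)
        + (-2 * c * q * P a v) * ph a v w + (-2 * c * q * P a w) * ph a w v
        + P v w ^ 2 + q ^ 2 * P a v ^ 2 + q ^ 2 * P a w ^ 2
        + (2 * q ^ 2 * P a v) * P a w
        + (2 * q * P a v) * P v w + (2 * q * P a w) * P w v := by
    intro a v w; rw [hs a w v, Ps w v]; ring
  have m1 : ∑ a ∈ S, ∑ v ∈ S, ∑ w ∈ S, ph a v w * P v w = T := by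
    rw [Finset.sum_comm, hT]
    refine Finset.sum_congr rfl fun v _ => ?_
    rw [Finset.sum_comm]
    refine Finset.sum_congr rfl fun w _ => ?_
    rw [← Finset.sum_mul, sq]
  have m2 : ∑ a ∈ S, ∑ v ∈ S, ∑ w ∈ S, (-2 * c * q * P a v) * ph a v w = 0 :=
    Finset.sum_eq_zero fun a _ => Finset.sum_eq_zero fun v _ => by
      rw [← Finset.mul_sum, hz, mul_zero]
  have m3 : ∑ a ∈ S, ∑ v ∈ S, ∑ w ∈ S, (-2 * c * q * P a w) * ph a w v = 0 :=
    Finset.sum_eq_zero fun a _ => by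
      rw [Finset.sum_comm]
      exact Finset.sum_eq_zero fun v _ => by rw [← Finset.mul_sum, hz, mul_zero]
  have m4 : ∑ a ∈ S, ∑ v ∈ S, ∑ w ∈ S, (2 * q ^ 2 * P a v) * P a w = 0 :=
    Finset.sum_eq_zero fun a _ => Finset.sum_eq_zero fun v _ => by
      rw [← Finset.mul_sum, Pz, mul_zero]
  have m5 : ∑ a ∈ S, ∑ v ∈ S, ∑ w ∈ S, (2 * q * P a v) * P v w = 0 :=
    Finset.sum_eq_zero fun a _ => Finset.sum_eq_zero fun v _ => by
      rw [← Finset.mul_sum, Pz, mul_zero]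
  have m6 : ∑ a ∈ S, ∑ v ∈ S, ∑ w ∈ S, (2 * q * P a w) * P w v = 0 :=
    Finset.sum_eq_zero fun a _ => by
      rw [Finset.sum_comm]
      exact Finset.sum_eq_zero fun v _ => by rw [← Finset.mul_sum, Pz, mul_zero]
  have m7 : ∑ _a ∈ S, ∑ v ∈ S, ∑ w ∈ S, P v w ^ 2 = N * T := by
    rw [Finset.sum_const, nsmul_eq_mul, hN]
  have m8 : ∑ a ∈ S, ∑ v ∈ S, ∑ _w ∈ S, P a v ^ 2 = N * T := by
    simp only [Finset.sum_const, nsmul_eq_mul, hN, ← Finset.mul_sum]; rfl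
  have m9 : ∑ a ∈ S, ∑ _v ∈ S, ∑ w ∈ S, P a w ^ 2 = N * T := by
    simp only [Finset.sum_const, nsmul_eq_mul, hN, ← Finset.mul_sum]; rfl
  have main : ∑ a ∈ S, ∑ v ∈ S, ∑ w ∈ S, (c * ph a v w - (P v w + q * (P a v + P a w))) ^ 2
      = c ^ 2 * R - 2 * c * T + N * T + 2 * q ^ 2 * (N * T) := by
    simp only [e, Finset.sum_add_distrib, Finset.sum_sub_distrib]
    rw [m2, m3, m4, m5, m6, m7]
    simp only [← Finset.mul_sum]
    rw [m1, m8, m9]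
    ring
  rw [b1, b2, b3, main] at key
  have hcc : (N - 2 * (1 + q) ^ 2 + 2 * N * q ^ 2 - 4 * q ^ 2) = c := by
    rw [hc]; linear_combination (2 * q) * hq1
  have : 0 ≤ c * (c * R - T) := by
    have h : c ^ 2 * R - 2 * c * T
      + (N - 2 * (1 + q) ^ 2 + 2 * N * q ^ 2 - 4 * q ^ 2) * T ≥ 0 := by linarith
    rw [hcc] at h; linarith
  have := nonneg_of_mul_nonneg_right this hc0
  linarith

end

section
variable {α : Type} [Fintype α] [DecidableEq α]

/-- Inner product of `g` with the indicator of the edge `{y,z}`. -/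
def pe (S : Finset α) (g : Perm α → ℝ) (y z : α) : ℝ :=
  ∑ m ∈ MM S, if m y = z then g m else 0

lemma pe_symm (S : Finset α) (g : Perm α → ℝ) (y z : α) : pe S g y z = pe S g z y := by
  refine Finset.sum_congr rfl fun m hm => ?_
  simp only [MM_eq_iff hm y z]

lemma pe_diag (S : Finset α) (g : Perm α → ℝ) (hg : ∑ m ∈ MM S, g m = 0) (y : α) :
    pe S g y y = 0 := by
  by_cases hy : y ∈ S
  · exact Finset.sum_eq_zero fun m hm => by rw [if_neg (MM_ne hm hy)]
  · rw [← hg]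
    exact Finset.sum_congr rfl fun m hm => by rw [if_pos (MM_fix hm hy)]

lemma pe_out (S : Finset α) (g : Perm α → ℝ) (hg : ∑ m ∈ MM S, g m = 0) (y z : α) (hy : y ∉ S) :
    pe S g y z = 0 := by
  by_cases h : y = z
  · subst h; exact pe_diag S g hg y
  · exact Finset.sum_eq_zero fun m hm => by rw [MM_fix hm hy, if_neg h]

lemma pe_sum (S T : Finset α) (hST : S ⊆ T) (g : Perm α → ℝ) (hg : ∑ m ∈ MM S, g m = 0) (y : α) :
    ∑ z ∈ T, pe S g y z = 0 := by
  by_cases hy : y ∈ S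
  · unfold pe
    rw [Finset.sum_comm]
    refine Eq.trans ?_ hg
    refine Finset.sum_congr rfl fun m hm => ?_
    rw [Finset.sum_ite_eq, if_pos (hST (MM_mem hm hy))]
  · exact Finset.sum_eq_zero fun z _ => pe_out S g hg y z hy

lemma sum_two_erase {S : Finset α} {y z : α} (hy : y ∈ S) (hz : z ∈ S.erase y) (F : α → ℝ) :
    ∑ v ∈ S, F v = F y + F z + ∑ v ∈ (S.erase y).erase z, F v := by
  rw [← Finset.add_sum_erase S F hy, ← Finset.add_sum_erase _ F hz]; ring

/-- (unnormalised) projection on the span of the edge indicators -/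
def ue (S : Finset α) (g : Perm α → ℝ) (m : Perm α) : ℝ := ∑ v ∈ S, pe S g v (m v)

lemma ue_edge (j : ℕ) (S : Finset α) (hS : S.card = 2 * (j + 2)) (g : Perm α → ℝ)
    (hg : ∑ m ∈ MM S, g m = 0) (y z : α) (hy : y ∈ S) (hz : z ∈ S) :
    ∑ m ∈ MM S, (if m y = z then ue S g m else 0) = 4 * (j + 1) * mu j * pe S g y z := by
  by_cases hyz : z = y
  · subst hyz
    rw [pe_diag S g hg, mul_zero]
    exact Finset.sum_eq_zero fun m hm => by rw [if_neg (MM_ne hm hy)]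
  have hz' : z ∈ S.erase y := Finset.mem_erase.2 ⟨hyz, hz⟩
  rw [sum_edge hy hz']
  set S2 := (S.erase y).erase z with hS2
  have cS2 : S2.card = 2 * (j + 1) := by
    rw [hS2, Finset.card_erase_of_mem hz', Finset.card_erase_of_mem hy]; omega
  have h1 : ∀ m ∈ MM S2, ue S g (m * swap z y) = 2 * pe S g y z + ∑ v ∈ S2, pe S g v (m v) := by
    intro m hm
    have my : m y = y := MM_fix hm (by simp [hS2])
    have mz : m z = z := MM_fix hm (by simp [hS2])
    unfold ue
    rw [sum_two_erase hy hz']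
    simp only [Perm.mul_apply, swap_apply_left, swap_apply_right, my, mz]
    rw [pe_symm S g z y, two_mul]
    congr 1
    refine Finset.sum_congr rfl fun v hv => ?_
    rw [swap_apply_of_ne_of_ne]
    · rintro rfl; simp [hS2] at hv
    · rintro rfl; simp [hS2] at hv
  rw [Finset.sum_congr rfl h1, Finset.sum_add_distrib]
  have h2 : ∑ _m ∈ MM S2, 2 * pe S g y z = mu (j + 1) * (2 * pe S g y z) := by
    rw [← card_MM (j + 1) S2 cS2, Finset.sum_mul]; simp
  have h3 : ∑ m ∈ MM S2, ∑ v ∈ S2, pe S g v (m v) = ∑ v ∈ S2, mu j * ∑ w ∈ S2, pe S g v w := by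
    rw [Finset.sum_comm]
    refine Finset.sum_congr rfl fun v hv => ?_
    rw [sum_vertex hv, ← Finset.add_sum_erase S2 _ hv, pe_diag S g hg, zero_add, Finset.mul_sum]
    refine Finset.sum_congr rfl fun w hw => ?_
    rw [← card_MM j ((S2.erase v).erase w), Finset.sum_mul]
    · refine Finset.sum_congr rfl fun m hm => ?_
      have mw : m w = w := MM_fix hm (by simp)
      simp [mw]
    · rw [Finset.card_erase_of_mem hw, Finset.card_erase_of_mem hv]; omega
  have h4 : ∀ v, ∑ w ∈ S2, pe S g v w = - pe S g v y - pe S g v z := by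
    intro v
    have := pe_sum S S le_rfl g hg v
    rw [sum_two_erase hy hz'] at this
    linarith
  have h5 : ∑ v ∈ S2, mu j * ∑ w ∈ S2, pe S g v w = mu j * (2 * pe S g y z) := by
    rw [← Finset.mul_sum]
    congr 1
    simp only [h4, Finset.sum_sub_distrib, Finset.sum_neg_distrib]
    rw [Finset.sum_congr rfl fun v _ => pe_symm S g v y, Finset.sum_congr rfl fun v _ => pe_symm S g v z,
      h4, h4, pe_diag S g hg, pe_diag S g hg, pe_symm S g z y]
    ring
  rw [h2, h3, h5]
  simp only [mu]
  ring

/-- pairing with `ue` -/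
lemma ue_pair (S : Finset α) (g h : Perm α → ℝ) :
    ∑ m ∈ MM S, ue S g m * h m = ∑ y ∈ S, ∑ z ∈ S, pe S g y z * pe S h y z := by
  have e : ∀ m ∈ MM S, ue S g m * h m
      = ∑ y ∈ S, ∑ z ∈ S, pe S g y z * (if m y = z then h m else 0) := by
    intro m hm
    unfold ue
    rw [Finset.sum_mul]
    refine Finset.sum_congr rfl fun y hy => ?_
    simp only [mul_ite, mul_zero]
    rw [Finset.sum_ite_eq, if_pos (MM_mem hm hy)]
  rw [Finset.sum_congr rfl e, Finset.sum_comm]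
  refine Finset.sum_congr rfl fun y _ => ?_
  rw [Finset.sum_comm]
  refine Finset.sum_congr rfl fun z _ => ?_
  rw [← Finset.mul_sum]; rfl

/-- The orthogonal decomposition. -/
lemma exists_decomp (j : ℕ) (S : Finset α) (hS : S.card = 2 * (j + 2)) (g : Perm α → ℝ)
    (hg : ∑ m ∈ MM S, g m = 0) :
    ∃ u w : Perm α → ℝ, (∀ m, g m = u m + w m) ∧
      (∀ m, u m = (1 / (4 * (j + 1) * mu j)) * ue S g m) ∧
      (∀ y ∈ S, ∀ z ∈ S, pe S w y z = 0) ∧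
      (∑ m ∈ MM S, u m * w m = 0) ∧
      (∑ m ∈ MM S, u m ^ 2 = (1 / (4 * (j + 1) * mu j)) * ∑ y ∈ S, ∑ z ∈ S, pe S g y z ^ 2) := by
  have hmu := mu_pos j
  set t : ℝ := 4 * (j + 1) * mu j with ht
  have ht0 : t ≠ 0 := by positivity
  have hw : ∀ y ∈ S, ∀ z ∈ S, pe S (fun m => g m - (1 / t) * ue S g m) y z = 0 := by
    intro y hy z hz
    have := ue_edge j S hS g hg y z hy hz
    rw [← ht] at this
    have e : pe S (fun m => g m - (1 / t) * ue S g m) y z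
      = pe S g y z - (1 / t) * ∑ m ∈ MM S, (if m y = z then ue S g m else 0) := by
      unfold pe
      rw [Finset.mul_sum, ← Finset.sum_sub_distrib]
      refine Finset.sum_congr rfl fun m _ => ?_
      split_ifs <;> simp
    rw [e, this]; field_simp; ring
  have ho : ∑ m ∈ MM S, ((1 / t) * ue S g m) * (g m - (1 / t) * ue S g m) = 0 := by
    simp only [mul_assoc]
    rw [← Finset.mul_sum, ue_pair S g (fun m => g m - (1 / t) * ue S g m)]
    rw [Finset.sum_eq_zero, mul_zero]
    intro y hy
    exact Finset.sum_eq_zero fun z hz => by rw [hw y hy z hz, mul_zero]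
  refine ⟨fun m => (1 / t) * ue S g m, fun m => g m - (1 / t) * ue S g m,
    fun m => by ring, fun m => rfl, hw, ho, ?_⟩
  have : ∑ m ∈ MM S, ((1 / t) * ue S g m) ^ 2 = (1 / t) * ∑ m ∈ MM S, ue S g m * g m := by
    rw [Finset.mul_sum, ← sub_eq_zero, ← Finset.sum_sub_distrib, ← neg_eq_zero,
      ← Finset.sum_neg_distrib, ← ho]
    refine Finset.sum_congr rfl fun m _ => ?_
    ring
  refine this.trans ?_
  rw [ue_pair]
  simp only [sq]

lemma edge_energy (j : ℕ) (S : Finset α) (hS : S.card = 2 * (j + 2)) (g : Perm α → ℝ)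
    (hg : ∑ m ∈ MM S, g m = 0) :
    ∑ y ∈ S, ∑ z ∈ S, pe S g y z ^ 2 ≤ 4 * (j + 1) * mu j * ∑ m ∈ MM S, g m ^ 2 := by
  obtain ⟨u, w, h1, -, -, h4, h5⟩ := exists_decomp j S hS g hg
  have hmu := mu_pos j
  have e : ∑ m ∈ MM S, g m ^ 2 = ∑ m ∈ MM S, u m ^ 2 + ∑ m ∈ MM S, w m ^ 2 := by
    rw [← Finset.sum_add_distrib, ← sub_eq_zero, ← Finset.sum_sub_distrib]
    rw [← mul_zero (2 : ℝ), ← h4, Finset.mul_sum]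
    refine Finset.sum_congr rfl fun m _ => ?_
    rw [h1 m]; ring
  have h6 : 0 ≤ ∑ m ∈ MM S, w m ^ 2 := Finset.sum_nonneg fun m _ => sq_nonneg _
  rw [e, h5]
  have : 0 < 4 * ((j : ℝ) + 1) * mu j := by positivity
  rw [mul_add, ← mul_assoc, mul_one_div_cancel this.ne']
  nlinarith

end

section
variable {α : Type} [Fintype α] [DecidableEq α]

/-- The odd Jucys--Murphy operator on near-perfect matchings of `S`. -/
def Jo (S : Finset α) (f : α → Perm α → ℝ) (a : α) (m : Perm α) : ℝ :=
  ∑ b ∈ S.erase a, f b (cj a b m)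

/-- Inner product of functions on near-perfect matchings. -/
def ip (S : Finset α) (f h : α → Perm α → ℝ) : ℝ :=
  ∑ a ∈ S, ∑ m ∈ MM (S.erase a), f a m * h a m

lemma sum_erase_comm (S : Finset α) (F : α → α → ℝ) :
    ∑ a ∈ S, ∑ b ∈ S.erase a, F a b = ∑ b ∈ S, ∑ a ∈ S.erase b, F a b := by
  refine Finset.sum_comm' ?_
  intro a b
  simp only [Finset.mem_erase]
  constructor
  · rintro ⟨h1, h2, h3⟩; exact ⟨⟨Ne.symm h2, h1⟩, h3⟩
  · rintro ⟨⟨h1, h2⟩, h3⟩; exact ⟨h2, Ne.symm h1, h3⟩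

lemma ip_Jo (S : Finset α) (f h : α → Perm α → ℝ) :
    ip S f (Jo S h)
      = ∑ a ∈ S, ∑ b ∈ S.erase a, ∑ m ∈ MM (S.erase a), f a m * h b (cj a b m) := by
  unfold ip Jo
  refine Finset.sum_congr rfl fun a _ => ?_
  simp only [Finset.mul_sum]
  rw [Finset.sum_comm]

lemma ip_comm (S : Finset α) (f h : α → Perm α → ℝ) : ip S f h = ip S h f := by
  unfold ip
  exact Finset.sum_congr rfl fun a _ => Finset.sum_congr rfl fun m _ => mul_comm _ _

lemma Jo_symm (S : Finset α) (f h : α → Perm α → ℝ) : ip S f (Jo S h) = ip S (Jo S f) h := by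
  rw [ip_comm S (Jo S f), ip_Jo, ip_Jo, sum_erase_comm]
  refine Finset.sum_congr rfl fun b hb => Finset.sum_congr rfl fun a ha => ?_
  have ha' := (Finset.mem_erase.1 ha).2
  rw [← sum_cj hb ha']
  refine Finset.sum_congr rfl fun m _ => ?_
  rw [cj_comm a b, cj_cj, mul_comm]

/-- restriction to the matchings through the edge `{y,z}` -/
def rs (f : α → Perm α → ℝ) (y z : α) (a : α) (m : Perm α) : ℝ := f a (m * swap z y)

/-- Rewriting a restricted sum. -/
lemma rs_sum (S : Finset α) (y z : α) (hy : y ∈ S) (hz : z ∈ S.erase y)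
    (F : α → Perm α → ℝ) :
    ∑ a ∈ (S.erase y).erase z, ∑ m ∈ MM (((S.erase y).erase z).erase a), F a (m * swap z y)
      = ∑ a ∈ S, ∑ m ∈ MM (S.erase a),
          if m y = z then F a m else 0 := by
  obtain ⟨hzy, hzS⟩ := Finset.mem_erase.1 hz
  rw [sum_two_erase hy hz]
  have e1 : ∑ m ∈ MM (S.erase y), (if m y = z then F y m else 0) = 0 :=
    Finset.sum_eq_zero fun m hm => by
      rw [if_neg]; rw [MM_fix hm (by simp)]; exact Ne.symm hzy
  have e2 : ∑ m ∈ MM (S.erase z), (if m y = z then F z m else 0) = 0 :=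
    Finset.sum_eq_zero fun m hm => by
      rw [if_neg]; rw [MM_eq_iff hm, MM_fix hm (by simp)]; exact hzy
  rw [e1, e2, zero_add, zero_add]
  refine Finset.sum_congr rfl fun a ha => ?_
  simp only [Finset.mem_erase] at ha
  obtain ⟨haz, hay, haS⟩ := ha
  rw [sum_edge (S := S.erase a) (by simp [Ne.symm hay, hy]) (by simp [Ne.symm haz, hzS, hzy])]
  have : ((S.erase y).erase z).erase a = ((S.erase a).erase y).erase z := by
    ext v; simp only [Finset.mem_erase]; tauto
  rw [this]

/-- Averaging of plain sums. -/
lemma avg_sum (k : ℕ) (S : Finset α) (hS : S.card = 2 * k + 1) (F : α → Perm α → ℝ) :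
    ∑ y ∈ S, ∑ z ∈ S.erase y, ∑ a ∈ (S.erase y).erase z,
      ∑ m ∈ MM (((S.erase y).erase z).erase a), F a (m * swap z y)
      = 2 * k * ∑ a ∈ S, ∑ m ∈ MM (S.erase a), F a m := by
  have e : ∀ y ∈ S, ∑ z ∈ S.erase y, ∑ a ∈ (S.erase y).erase z,
      ∑ m ∈ MM (((S.erase y).erase z).erase a), F a (m * swap z y)
      = ∑ a ∈ S, ∑ m ∈ MM (S.erase a), if y ∈ S.erase a then F a m else 0 := by
    intro y hy
    rw [Finset.sum_congr rfl fun z hz => rs_sum S y z hy hz F, Finset.sum_comm]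
    refine Finset.sum_congr rfl fun a ha => ?_
    rw [Finset.sum_comm]
    refine Finset.sum_congr rfl fun m hm => ?_
    rw [Finset.sum_ite_eq]
    congr 1
    simp only [eq_iff_iff]
    by_cases h : y ∈ S.erase a
    · have := MM_mem hm h
      have h2 := MM_ne hm h
      simp only [Finset.mem_erase] at this h
      simp [h, this, h2]
    · rw [MM_fix hm h]; simp at h; simp [hy]; tauto
  rw [Finset.sum_congr rfl e, Finset.sum_comm, Finset.mul_sum]
  refine Finset.sum_congr rfl fun a ha => ?_
  rw [Finset.sum_comm, Finset.mul_sum]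
  refine Finset.sum_congr rfl fun m hm => ?_
  rw [← Finset.sum_filter, Finset.filter_mem_eq_inter,
    Finset.inter_eq_right.2 (Finset.erase_subset _ _), Finset.sum_const,
    Finset.card_erase_of_mem ha, hS, nsmul_eq_mul]
  simp

lemma avg_form (k : ℕ) (hk : 1 ≤ k) (S : Finset α) (hS : S.card = 2 * k + 1)
    (f : α → Perm α → ℝ) :
    ∑ y ∈ S, ∑ z ∈ S.erase y, ip ((S.erase y).erase z) (rs f y z)
        (Jo ((S.erase y).erase z) (rs f y z))
      = (2 * k - 2) * ip S f (Jo S f) := by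
  have e : ∀ y ∈ S, ∀ z ∈ S.erase y, ip ((S.erase y).erase z) (rs f y z)
        (Jo ((S.erase y).erase z) (rs f y z))
      = ∑ a ∈ S, ∑ m ∈ MM (S.erase a), ∑ b ∈ S.erase a,
        if m y = z then (if y ≠ b ∧ z ≠ b then f a m * f b (cj a b m) else 0) else 0 := by
    intro y hy z hz
    have h1 := rs_sum S y z hy hz (fun a m => ∑ b ∈ S.erase a,
      if y ≠ b ∧ z ≠ b then f a m * f b (cj a b m) else 0)
    have h2 : ∀ a m, (if m y = z then ∑ b ∈ S.erase a,
          (if y ≠ b ∧ z ≠ b then f a m * f b (cj a b m) else 0) else 0)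
        = ∑ b ∈ S.erase a, if m y = z then
          (if y ≠ b ∧ z ≠ b then f a m * f b (cj a b m) else 0) else 0 := by
      intro a m; split_ifs <;> simp
    simp only [h2] at h1
    rw [← h1]
    unfold ip
    refine Finset.sum_congr rfl fun a ha => Finset.sum_congr rfl fun m _ => ?_
    unfold Jo rs
    rw [Finset.mul_sum, ← Finset.sum_filter]
    have : ((S.erase y).erase z).erase a = (S.erase a).filter (fun b => y ≠ b ∧ z ≠ b) := by
      ext v; simp only [Finset.mem_erase, Finset.mem_filter]; tauto
    rw [this]
    refine Finset.sum_congr rfl fun b hb => ?_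
    simp only [Finset.mem_erase, Finset.mem_filter] at ha hb
    rw [cj_mul_swap (Ne.symm ha.2.1) hb.2.1 (Ne.symm ha.1) hb.2.2]
  rw [Finset.sum_congr rfl fun y hy => Finset.sum_congr rfl fun z hz => e y hy z hz]
  have e2 : ∀ y ∈ S, ∑ z ∈ S.erase y, ∑ a ∈ S, ∑ m ∈ MM (S.erase a), ∑ b ∈ S.erase a,
        (if m y = z then (if y ≠ b ∧ z ≠ b then f a m * f b (cj a b m) else 0) else 0)
      = ∑ a ∈ S, ∑ m ∈ MM (S.erase a), ∑ b ∈ S.erase a,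
        if y ∈ ((S.erase a).erase b).erase (m b) then f a m * f b (cj a b m) else 0 := by
    intro y hy
    rw [Finset.sum_comm]
    refine Finset.sum_congr rfl fun a ha => ?_
    rw [Finset.sum_comm]
    refine Finset.sum_congr rfl fun m hm => ?_
    rw [Finset.sum_comm]
    refine Finset.sum_congr rfl fun b hb => ?_
    rw [Finset.sum_ite_eq, ← ite_and]
    congr 1
    simp only [eq_iff_iff]
    by_cases h : y ∈ S.erase a
    · have h1 := MM_mem hm h
      have h2 := MM_ne hm h
      have h3 : y = m b ↔ m y = b := by rw [eq_comm, MM_eq_iff hm]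
      simp only [Finset.mem_erase] at h1 h ⊢
      simp only [ne_eq, h3]
      tauto
    · rw [MM_fix hm h]; simp at h; simp [hy]; tauto
  rw [Finset.sum_congr rfl e2, Finset.sum_comm]
  unfold ip Jo
  rw [Finset.mul_sum]
  refine Finset.sum_congr rfl fun a ha => ?_
  rw [Finset.sum_comm, Finset.mul_sum]
  refine Finset.sum_congr rfl fun m hm => ?_
  rw [Finset.sum_comm, Finset.mul_sum, Finset.mul_sum]
  refine Finset.sum_congr rfl fun b hb => ?_
  have hsub : ((S.erase a).erase b).erase (m b) ⊆ S :=
    (Finset.erase_subset _ _).trans ((Finset.erase_subset _ _).trans (Finset.erase_subset _ _))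
  have hcard : (((S.erase a).erase b).erase (m b)).card = 2 * k - 2 := by
    rw [Finset.card_erase_of_mem, Finset.card_erase_of_mem hb, Finset.card_erase_of_mem ha]
    · omega
    · exact Finset.mem_erase.2 ⟨MM_ne hm hb, MM_mem hm hb⟩
  rw [← Finset.sum_filter, Finset.filter_mem_eq_inter, Finset.inter_eq_right.2 hsub,
    Finset.sum_const, hcard, nsmul_eq_mul, Nat.cast_sub (by omega)]
  push_cast; ring

end

section
variable {α : Type} [Fintype α] [DecidableEq α]

lemma J_base (S : Finset α) (hS : S.card = 3) : ∃ p : α → Perm α,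
    (∀ a ∈ S, MM (S.erase a) = {p a}) ∧ ∀ f : α → Perm α → ℝ,
    ip S f f = ∑ a ∈ S, f a (p a) ^ 2 ∧
    ip S f (Jo S f) = (∑ a ∈ S, f a (p a)) ^ 2 - ∑ a ∈ S, f a (p a) ^ 2 := by
  have h : ∀ a, ∃ p : Perm α, a ∈ S → MM (S.erase a) = {p} := by
    intro a
    by_cases ha : a ∈ S
    · have h1 := card_MM 1 (S.erase a) (by rw [Finset.card_erase_of_mem ha, hS])
      have h2 : (MM (S.erase a)).card = 1 := by
        have : ((MM (S.erase a)).card : ℝ) = 1 := by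
          simpa [mu] using h1
        exact_mod_cast this
      obtain ⟨p, hp⟩ := Finset.card_eq_one.1 h2
      exact ⟨p, fun _ => hp⟩
    · exact ⟨1, fun h => absurd h ha⟩
  choose p hp using h
  refine ⟨p, hp, fun f => ?_⟩
  have e : ∀ g : α → Perm α → ℝ, ip S f g = ∑ a ∈ S, f a (p a) * g a (p a) := by
    intro g
    unfold ip
    refine Finset.sum_congr rfl fun a ha => ?_
    rw [hp a ha, Finset.sum_singleton]
  constructor
  · rw [e]; simp only [sq]
  · rw [e, sq, Finset.sum_mul, ← Finset.sum_sub_distrib]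
    refine Finset.sum_congr rfl fun a ha => ?_
    have : Jo S f a (p a) = ∑ b ∈ S.erase a, f b (p b) := by
      unfold Jo
      refine Finset.sum_congr rfl fun b hb => ?_
      have hb' := (Finset.mem_erase.1 hb).2
      have : cj a b (p a) ∈ MM (S.erase b) := cj_mem ha hb' (by rw [hp a ha]; simp)
      rw [hp b hb', Finset.mem_singleton] at this
      rw [this]
    rw [this, ← Finset.add_sum_erase S _ ha]
    ring

lemma ip_rs (k : ℕ) (S : Finset α) (hS : S.card = 2 * k + 1) (f : α → Perm α → ℝ) :
    ∑ y ∈ S, ∑ z ∈ S.erase y, ip ((S.erase y).erase z) (rs f y z) (rs f y z)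
      = 2 * k * ip S f f :=
  avg_sum k S hS (fun a m => f a m * f a m)

lemma card_two {S : Finset α} {n : ℕ} (hS : S.card = n + 2) {y z : α} (hy : y ∈ S)
    (hz : z ∈ S.erase y) : ((S.erase y).erase z).card = n := by
  rw [Finset.card_erase_of_mem hz, Finset.card_erase_of_mem hy]; omega

lemma J_lower (k : ℕ) : ∀ (S : Finset α), S.card = 2 * (k + 1) + 1 → ∀ f : α → Perm α → ℝ,
    -((k : ℝ) + 1) * ip S f f ≤ ip S f (Jo S f) := by
  induction k with
  | zero =>
    intro S hS f
    obtain ⟨p, -, hp⟩ := J_base S hS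
    rw [(hp f).1, (hp f).2]
    have := sq_nonneg (∑ a ∈ S, f a (p a))
    push_cast; linarith
  | succ k ih =>
    intro S hS f
    have h1 := avg_form (k + 2) (by omega) S hS f
    have h2 := ip_rs (k + 2) S hS f
    have h3 : ∑ y ∈ S, ∑ z ∈ S.erase y, -((k : ℝ) + 1) *
        ip ((S.erase y).erase z) (rs f y z) (rs f y z) ≤
        ∑ y ∈ S, ∑ z ∈ S.erase y, ip ((S.erase y).erase z) (rs f y z)
        (Jo ((S.erase y).erase z) (rs f y z)) :=
      Finset.sum_le_sum fun y hy => Finset.sum_le_sum fun z hz =>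
        ih _ (card_two (by omega) hy hz) _
    simp only [← Finset.mul_sum] at h3
    rw [h1, h2] at h3
    push_cast at h3 ⊢
    have hk : (0 : ℝ) < k + 1 := by positivity
    have h4 : 0 ≤ 2 * ((k : ℝ) + 1) * (ip S f (Jo S f) + ((k : ℝ) + 1 + 1) * ip S f f) := by
      linarith
    have := nonneg_of_mul_nonneg_right h4 (by positivity)
    linarith

/-- Reduction of the general upper bound to the mean zero case. -/
lemma J_upper_of (k : ℕ) (S : Finset α) (hS : S.card = 2 * (k + 1) + 1)
    (H : ∀ f : α → Perm α → ℝ, (∀ a ∈ S, ∑ m ∈ MM (S.erase a), f a m = 0) →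
      ip S f (Jo S f) ≤ 2 * k * ip S f f) (f : α → Perm α → ℝ) (s : α → ℝ)
    (hs : ∀ a ∈ S, s a = ∑ m ∈ MM (S.erase a), f a m) :
    ip S f (Jo S f) ≤ 2 * k * ip S f f
      + ((∑ a ∈ S, s a) ^ 2 - (2 * k + 1) * ∑ a ∈ S, s a ^ 2) / mu (k + 1) := by
  have hmu := mu_pos (k + 1)
  set M := mu (k + 1) with hM
  have hcard : ∀ a ∈ S, ∑ _m ∈ MM (S.erase a), (1 : ℝ) = M := fun a ha =>
    card_MM (k + 1) _ (by rw [Finset.card_erase_of_mem ha]; omega)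
  set h : α → Perm α → ℝ := fun a m => f a m - s a / M with hh
  have h0 : ∀ a ∈ S, ∑ m ∈ MM (S.erase a), h a m = 0 := by
    intro a ha
    have : ∑ m ∈ MM (S.erase a), h a m
        = ∑ m ∈ MM (S.erase a), f a m - s a / M * ∑ _m ∈ MM (S.erase a), (1 : ℝ) := by
      rw [Finset.mul_sum, ← Finset.sum_sub_distrib]; simp [hh]
    rw [this, hcard a ha, hs a ha]
    field_simp
    ring
  have key := H h h0
  have e1 : ip S f f = ip S h h + (∑ a ∈ S, s a ^ 2) / M := by
    unfold ip
    rw [Finset.sum_div, ← Finset.sum_add_distrib]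
    refine Finset.sum_congr rfl fun a ha => ?_
    have : ∑ m ∈ MM (S.erase a), f a m * f a m = ∑ m ∈ MM (S.erase a), h a m * h a m
        + 2 * (s a / M) * ∑ m ∈ MM (S.erase a), h a m
        + (s a / M) ^ 2 * ∑ _m ∈ MM (S.erase a), (1 : ℝ) := by
      rw [Finset.mul_sum, Finset.mul_sum, ← Finset.sum_add_distrib, ← Finset.sum_add_distrib]
      refine Finset.sum_congr rfl fun m _ => ?_
      simp only [hh]; ring
    rw [this, h0 a ha, hcard a ha]
    field_simp
    ring
  have e2 : ip S f (Jo S f) = ip S h (Jo S h) + ∑ a ∈ S, ∑ b ∈ S.erase a, s a * s b / M := by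
    rw [ip_Jo, ip_Jo, ← Finset.sum_add_distrib]
    refine Finset.sum_congr rfl fun a ha => ?_
    rw [← Finset.sum_add_distrib]
    refine Finset.sum_congr rfl fun b hb => ?_
    have hb' := (Finset.mem_erase.1 hb).2
    have : ∑ m ∈ MM (S.erase a), f a m * f b (cj a b m)
        = ∑ m ∈ MM (S.erase a), h a m * h b (cj a b m)
        + (s b / M) * ∑ m ∈ MM (S.erase a), h a m
        + (s a / M) * ∑ m ∈ MM (S.erase a), h b (cj a b m)
        + (s a / M) * (s b / M) * ∑ _m ∈ MM (S.erase a), (1 : ℝ) := by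
      rw [Finset.mul_sum, Finset.mul_sum, Finset.mul_sum, ← Finset.sum_add_distrib,
        ← Finset.sum_add_distrib, ← Finset.sum_add_distrib]
      refine Finset.sum_congr rfl fun m _ => ?_
      simp only [hh]; ring
    rw [this, h0 a ha, sum_cj ha hb' (h b), h0 b hb', hcard a ha]
    field_simp
    ring
  have e3 : ∑ a ∈ S, ∑ b ∈ S.erase a, s a * s b / M
      = ((∑ a ∈ S, s a) ^ 2 - ∑ a ∈ S, s a ^ 2) / M := by
    rw [sq, Finset.sum_mul, ← Finset.sum_sub_distrib, Finset.sum_div]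
    refine Finset.sum_congr rfl fun a ha => ?_
    rw [← Finset.add_sum_erase S s ha, ← Finset.sum_div, ← Finset.mul_sum]
    ring
  rw [e2, e3, e1]
  have : 2 * ↑k * (ip S h h + (∑ a ∈ S, s a ^ 2) / M) +
      ((∑ a ∈ S, s a) ^ 2 - (2 * ↑k + 1) * ∑ a ∈ S, s a ^ 2) / M
      = 2 * k * ip S h h + ((∑ a ∈ S, s a) ^ 2 - ∑ a ∈ S, s a ^ 2) / M := by
    field_simp; ring
  rw [this]
  linarith

lemma J_upper0 (k : ℕ) : ∀ (S : Finset α), S.card = 2 * (k + 1) + 1 → ∀ f : α → Perm α → ℝ,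
    (∀ a ∈ S, ∑ m ∈ MM (S.erase a), f a m = 0) →
    ip S f (Jo S f) ≤ 2 * k * ip S f f := by
  induction k with
  | zero =>
    intro S hS f hf
    obtain ⟨p, hp1, hp⟩ := J_base S hS
    have : ∀ a ∈ S, f a (p a) = 0 := by
      intro a ha
      have := hf a ha
      rwa [hp1 a ha, Finset.sum_singleton] at this
    rw [(hp f).2, Finset.sum_eq_zero this]
    rw [Finset.sum_eq_zero fun a ha => by rw [this a ha]; simp]
    simp
  | succ k ih =>
    intro S hS f hf
    set ph : α → α → α → ℝ := fun a y z => if a ∈ S then pe (S.erase a) (f a) y z else 0 with hph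
    have phS : ∀ a ∈ S, ∀ y z, ph a y z = pe (S.erase a) (f a) y z := by
      intro a ha y z; simp [hph, ha]
    have p1 : ∀ a v w, ph a v w = ph a w v := by
      intro a v w; simp only [hph]; split_ifs; exacts [pe_symm _ _ _ _, rfl]
    have p2 : ∀ a v, ph a v v = 0 := by
      intro a v; simp only [hph]; split_ifs with h; exacts [pe_diag _ _ (hf a h) _, rfl]
    have p3 : ∀ a w, ph a a w = 0 := by
      intro a w; simp only [hph]; split_ifs with h
      exacts [pe_out _ _ (hf a h) _ _ (by simp), rfl]
    have p4 : ∀ a v, ∑ w ∈ S, ph a v w = 0 := by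
      intro a v; simp only [hph]; split_ifs with h
      exacts [pe_sum _ _ (Finset.erase_subset _ _) _ (hf a h) _, by simp]
    have arr := array_ineq S (2 * k + 5) (by rw [hS]; push_cast; ring) (by
      have : (0 : ℝ) ≤ k := by positivity
      linarith) ph p1 p2 p3 p4
    have h1 := avg_form (k + 2) (by omega) S hS f
    have h2 := ip_rs (k + 2) S hS f
    have h3 : ∀ y ∈ S, ∀ z ∈ S.erase y, ip ((S.erase y).erase z) (rs f y z)
        (Jo ((S.erase y).erase z) (rs f y z)) ≤ 2 * k *
        ip ((S.erase y).erase z) (rs f y z) (rs f y z)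
        + ((∑ a ∈ S, ph a y z) ^ 2 - (2 * k + 1) * ∑ a ∈ S, ph a y z ^ 2) / mu (k + 1) := by
      intro y hy z hz
      have hc : ((S.erase y).erase z).card = 2 * (k + 1) + 1 := card_two (by omega) hy hz
      have := J_upper_of k _ hc (ih _ hc) (rs f y z) (fun a => ph a y z) ?_
      · rw [sum_two_erase hy hz (fun a => ph a y z), sum_two_erase hy hz (fun a => ph a y z ^ 2)]
        rw [p3, p1 z, p3]
        simpa using this
      · intro a ha
        simp only [Finset.mem_erase] at ha
        obtain ⟨haz, hay, haS⟩ := ha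
        obtain ⟨hzy, hzS⟩ := Finset.mem_erase.1 hz
        rw [phS a haS]
        unfold pe rs
        rw [sum_edge (S := S.erase a) (by simp [Ne.symm hay, hy])
          (by simp [Ne.symm haz, hzS, hzy])]
        have : ((S.erase y).erase z).erase a = ((S.erase a).erase y).erase z := by
          ext v; simp only [Finset.mem_erase]; tauto
        rw [this]
    have h4 := Finset.sum_le_sum fun y hy => Finset.sum_le_sum fun z hz => h3 y hy z hz
    have hmu := mu_pos k
    have hmu1 := mu_pos (k + 1)
    set R := ∑ a ∈ S, ∑ y ∈ S, ∑ z ∈ S, ph a y z ^ 2 with hR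
    set T := ∑ y ∈ S, ∑ z ∈ S, (∑ a ∈ S, ph a y z) ^ 2 with hT
    have h5 : ∑ y ∈ S, ∑ z ∈ S.erase y,
        ((∑ a ∈ S, ph a y z) ^ 2 - (2 * k + 1) * ∑ a ∈ S, ph a y z ^ 2) / mu (k + 1)
        = (T - (2 * k + 1) * R) / mu (k + 1) := by
      have hR' : R = ∑ y ∈ S, ∑ z ∈ S, ∑ a ∈ S, ph a y z ^ 2 := by
        rw [hR, Finset.sum_comm]
        exact Finset.sum_congr rfl fun y _ => Finset.sum_comm
      rw [hR', hT, Finset.mul_sum, ← Finset.sum_sub_distrib, Finset.sum_div]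
      refine Finset.sum_congr rfl fun y hy => ?_
      rw [Finset.mul_sum, ← Finset.sum_sub_distrib, Finset.sum_div,
        ← Finset.add_sum_erase S _ hy]
      simp [p2]
    have h6 : R ≤ 4 * (k + 1) * mu k * ip S f f := by
      unfold ip
      rw [hR, Finset.mul_sum]
      refine Finset.sum_le_sum fun a ha => ?_
      have := edge_energy k (S.erase a) (by rw [Finset.card_erase_of_mem ha]; omega) (f a) (hf a ha)
      simp only [← sq]
      refine le_trans (le_of_eq ?_) this
      rw [← Finset.add_sum_erase S _ ha]
      simp only [p3]
      simp only [ne_eq, OfNat.ofNat_ne_zero, not_false_eq_true, zero_pow, Finset.sum_const_zero,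
        zero_add]
      refine Finset.sum_congr rfl fun y _ => ?_
      rw [← Finset.add_sum_erase S _ ha, p1, p3]
      simp [phS a ha]
    simp only [Finset.sum_add_distrib, ← Finset.mul_sum] at h4
    rw [h1, h2, h5] at h4
    have hk : (0 : ℝ) < (k : ℝ) + 1 := by positivity
    have h7 : (T - (2 * k + 1) * R) / mu (k + 1) ≤ 4 * ip S f f := by
      rw [div_le_iff₀ hmu1]
      have h8 : T - (2 * k + 1) * R ≤ ((2 * k + 1) / (k + 1)) * R := by
        have : ((2 : ℝ) * k + 5 - 2 - 2 / (2 * k + 5 - 3)) = (2 * k + 1) + (2 * k + 1) / (k + 1) := by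
          rw [show (2 : ℝ) * k + 5 - 3 = 2 * (k + 1) by ring]
          field_simp; ring
        rw [this] at arr
        linarith
      refine h8.trans ?_
      have h9 := mul_le_mul_of_nonneg_left h6 (show (0 : ℝ) ≤ (2 * k + 1) / (k + 1) by positivity)
      refine h9.trans (le_of_eq ?_)
      simp only [mu]
      field_simp
    push_cast at h4 ⊢
    have h10 : 0 ≤ 2 * ((k : ℝ) + 1) * (2 * (k + 1) * ip S f f - ip S f (Jo S f)) := by
      linarith
    have := nonneg_of_mul_nonneg_right h10 (by positivity)
    linarith

lemma ip_comb (S : Finset α) (c d : ℝ) (f g h : α → Perm α → ℝ) :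
    ip S (fun a m => c * f a m + d * g a m) h = c * ip S f h + d * ip S g h := by
  unfold ip
  simp only [Finset.mul_sum, ← Finset.sum_add_distrib]
  exact Finset.sum_congr rfl fun a _ => Finset.sum_congr rfl fun m _ => by ring

lemma Jo_comb (S : Finset α) (c d : ℝ) (f g : α → Perm α → ℝ) :
    Jo S (fun a m => c * f a m + d * g a m) = fun a m => c * Jo S f a m + d * Jo S g a m := by
  funext a m
  unfold Jo
  simp only [Finset.mul_sum, ← Finset.sum_add_distrib]

lemma J_norm (k : ℕ) (S : Finset α) (hS : S.card = 2 * (k + 1) + 1) (f : α → Perm α → ℝ)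
    (hf : ∀ a ∈ S, ∑ m ∈ MM (S.erase a), f a m = 0) (c : ℝ) (hc1 : (k : ℝ) + 1 ≤ c)
    (hc2 : 2 * (k : ℝ) ≤ c) :
    ip S (Jo S f) (Jo S f) ≤ c ^ 2 * ip S f f := by
  have hpos : ∀ h : α → Perm α → ℝ, 0 ≤ ip S h h := fun h =>
    Finset.sum_nonneg fun a _ => Finset.sum_nonneg fun m _ => mul_self_nonneg _
  have hc : 0 < c := lt_of_lt_of_le (by positivity) hc1
  set g := Jo S f with hg
  have hg0 : ∀ a ∈ S, ∑ m ∈ MM (S.erase a), g a m = 0 := by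
    intro a ha
    simp only [hg, Jo]
    rw [Finset.sum_comm]
    refine Finset.sum_eq_zero fun b hb => ?_
    have hb' := (Finset.mem_erase.1 hb).2
    rw [sum_cj ha hb' (f b), hf b hb']
  have u1 := J_upper0 k S hS (fun a m => c * f a m + 1 * g a m) (by
    intro a ha
    rw [Finset.sum_add_distrib, ← Finset.mul_sum, ← Finset.mul_sum, hf a ha, hg0 a ha]; ring)
  have u2 := J_lower k S hS (fun a m => c * f a m + (-1) * g a m)
  have q1 := mul_le_mul_of_nonneg_right hc2 (hpos (fun a m => c * f a m + 1 * g a m))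
  have q2 := mul_le_mul_of_nonneg_right hc1 (hpos (fun a m => c * f a m + (-1) * g a m))
  have v1 := u1.trans q1
  have v2 : -(c * ip S (fun a m => c * f a m + (-1) * g a m) (fun a m => c * f a m + (-1) * g a m))
    ≤ _ := le_trans (by linarith) u2
  have s1 : ip S f (Jo S g) = ip S g g := by rw [Jo_symm, ← hg]
  have s2 : ip S g f = ip S f g := ip_comm _ _ _
  simp only [Jo_comb, ip_comb] at v1 v2
  rw [ip_comm S f (fun a m => _), ip_comm S g (fun a m => _), ip_comm S f (fun a m => _),
    ip_comm S g (fun a m => _)] at v1 v2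
  simp only [ip_comb] at v1 v2
  rw [← hg, ip_comm S (Jo S g) f, s1, s2] at v1 v2
  have : 0 ≤ (2 * c) * (c ^ 2 * ip S f f - ip S g g) := by nlinarith
  have := nonneg_of_mul_nonneg_right this (by positivity)
  linarith

end

section
variable {α : Type} [Fintype α] [DecidableEq α]

/-- `m ∪ m'` is a Hamiltonian cycle on `S` (connectivity formulation). -/
def Ham (S : Finset α) (m m' : Perm α) : Prop :=
  ∀ T ⊆ S, T.Nonempty → (∀ v ∈ T, m v ∈ T) → (∀ v ∈ T, m' v ∈ T) → T = S

lemma Ham_symm (S : Finset α) (m m' : Perm α) : Ham S m m' ↔ Ham S m' m :=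
  ⟨fun h T a b c d => h T a b d c, fun h T a b c d => h T a b d c⟩

lemma Ham_rec {S : Finset α} {x a b : α} (hx : x ∈ S) (ha : a ∈ S.erase x) (hb : b ∈ S.erase x)
    (hab : b ≠ a) {m m' : Perm α} (hm : m ∈ MM ((S.erase x).erase a))
    (hm' : m' ∈ MM ((S.erase x).erase b)) :
    Ham S (m * swap a x) (m' * swap b x) ↔ Ham ((S.erase x).erase b) (cj a b m) m' := by
  obtain ⟨hax, haS⟩ := Finset.mem_erase.1 ha
  obtain ⟨hbx, hbS⟩ := Finset.mem_erase.1 hb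
  have ma : m a = a := MM_fix hm (by simp)
  have mx : m x = x := MM_fix hm (by simp)
  have mb' : m' b = b := MM_fix hm' (by simp)
  have mx' : m' x = x := MM_fix hm' (by simp)
  have hbm : b ∈ (S.erase x).erase a := Finset.mem_erase.2 ⟨hab, hb⟩
  have mbne : m b ≠ b := MM_ne hm hbm
  have mbmem := MM_mem hm hbm
  simp only [Finset.mem_erase] at mbmem
  obtain ⟨mba, mbx, mbS⟩ := mbmem
  have mmb : m (m b) = b := MM_inv hm b
  have p1 : (m * swap a x) x = a := by simp [ma]
  have p2 : (m * swap a x) a = x := by simp [mx]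
  have p3 : ∀ v, v ≠ a → v ≠ x → (m * swap a x) v = m v := by
    intro v h1 h2; simp [swap_apply_of_ne_of_ne h1 h2]
  have q1 : (m' * swap b x) x = b := by simp [mb']
  have q2 : (m' * swap b x) b = x := by simp [mx']
  have q3 : ∀ v, v ≠ b → v ≠ x → (m' * swap b x) v = m' v := by
    intro v h1 h2; simp [swap_apply_of_ne_of_ne h1 h2]
  have n1 : cj a b m a = m b := by
    simp [cj, swap_apply_of_ne_of_ne mba mbne]
  have n2 : cj a b m (m b) = a := by
    simp [cj, swap_apply_of_ne_of_ne mba mbne, mmb]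
  have n3 : ∀ v, v ≠ a → v ≠ b → v ≠ m b → cj a b m v = m v := by
    intro v h1 h2 h3
    have h4 : m v ≠ a := fun h => h1 (by rw [← MM_inv hm v, h, ma])
    have h5 : m v ≠ b := fun h => h3 (by rw [← h, MM_inv hm v])
    simp [cj, swap_apply_of_ne_of_ne h1 h2, swap_apply_of_ne_of_ne h4 h5]
  constructor
  · intro H T hTS hTn h1 h2
    have hTx : x ∉ T := fun h => by simpa using hTS h
    have hTb : b ∉ T := fun h => by simpa using hTS h
    have key : (if a ∈ T then insert x (insert b T) else T) = S := by
      apply H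
      · split_ifs
        · intro v hv
          simp only [Finset.mem_insert] at hv
          rcases hv with rfl | rfl | hv
          · exact hx
          · exact hbS
          · exact Finset.mem_of_mem_erase (Finset.mem_of_mem_erase (hTS hv))
        · exact fun v hv => Finset.mem_of_mem_erase (Finset.mem_of_mem_erase (hTS hv))
      · split_ifs
        · simp
        · exact hTn
      · split_ifs with haT
        · intro v hv
          have := h1 a haT
          rw [n1] at this
          by_cases e1 : v = x
          · subst e1; rw [p1]; simp [haT]
          by_cases e2 : v = b
          · subst e2; rw [p3 _ hab hbx]; simp [this]
          by_cases e3 : v = a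
          · subst e3; rw [p2]; simp
          by_cases e4 : v = m b
          · subst e4; rw [p3 _ mba mbx, mmb]; simp
          have hvT : v ∈ T := by simpa [e1, e2] using hv
          have := h1 v hvT
          rw [n3 v e3 e2 e4] at this
          rw [p3 v e3 e1]; simp [this]
        · intro v hv
          have e1 : v ≠ x := fun h => hTx (h ▸ hv)
          have e2 : v ≠ b := fun h => hTb (h ▸ hv)
          have e3 : v ≠ a := fun h => haT (h ▸ hv)
          have e4 : v ≠ m b := fun h => haT (by
            have := h1 v hv
            rwa [h, n2] at this)
          have := h1 v hv
          rw [n3 v e3 e2 e4] at this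
          rw [p3 v e3 e1]; exact this
      · split_ifs with haT
        · intro v hv
          by_cases e1 : v = x
          · subst e1; rw [q1]; simp
          by_cases e2 : v = b
          · subst e2; rw [q2]; simp
          have hvT : v ∈ T := by simpa [e1, e2] using hv
          rw [q3 v e2 e1]; simp [h2 v hvT]
        · intro v hv
          have e1 : v ≠ x := fun h => hTx (h ▸ hv)
          have e2 : v ≠ b := fun h => hTb (h ▸ hv)
          rw [q3 v e2 e1]; exact h2 v hv
    split_ifs at key with haT
    · rw [← key]
      ext v
      simp only [Finset.mem_erase, Finset.mem_insert]
      constructor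
      · intro h
        exact ⟨fun e => hTb (e ▸ h), fun e => hTx (e ▸ h), Or.inr (Or.inr h)⟩
      · rintro ⟨e1, e2, h | h | h⟩
        · exact absurd h e2
        · exact absurd h e1
        · exact h
    · exact absurd (key ▸ hx) hTx
  · intro H T hTS hTn h1 h2
    have xa : x ∈ T → a ∈ T := fun h => p1 ▸ h1 x h
    have ax : a ∈ T → x ∈ T := fun h => p2 ▸ h1 a h
    have xb : x ∈ T → b ∈ T := fun h => q1 ▸ h2 x h
    have bx : b ∈ T → x ∈ T := fun h => q2 ▸ h2 b h
    have key : (T.erase x).erase b = (S.erase x).erase b := by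
      apply H
      · exact Finset.erase_subset_erase _ (Finset.erase_subset_erase _ hTS)
      · by_cases haT : a ∈ T
        · exact ⟨a, by simp [haT, hax, Ne.symm hab]⟩
        · obtain ⟨v, hv⟩ := hTn
          refine ⟨v, ?_⟩
          simp only [Finset.mem_erase]
          refine ⟨?_, ?_, hv⟩
          · rintro rfl; exact haT (xa (bx hv))
          · rintro rfl; exact haT (xa hv)
      · intro v hv
        simp only [Finset.mem_erase] at hv ⊢
        obtain ⟨e2, e1, hvT⟩ := hv
        by_cases e3 : v = a
        · subst e3
          rw [n1]
          have := h1 b (xb (ax hvT))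
          rw [p3 b hab hbx] at this
          exact ⟨mbne, mbx, this⟩
        by_cases e4 : v = m b
        · subst e4
          rw [n2]
          have := h1 _ hvT
          rw [p3 _ mba mbx, mmb] at this
          exact ⟨Ne.symm hab, hax, xa (bx this)⟩
        rw [n3 v e3 e2 e4]
        have := h1 v hvT
        rw [p3 v e3 e1] at this
        refine ⟨?_, ?_, this⟩
        · intro h; exact e4 (by rw [← h, MM_inv hm v])
        · intro h; exact e1 (by rw [← MM_inv hm v, h, mx])
      · intro v hv
        simp only [Finset.mem_erase] at hv ⊢
        obtain ⟨e2, e1, hvT⟩ := hv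
        have := h2 v hvT
        rw [q3 v e2 e1] at this
        refine ⟨?_, ?_, this⟩
        · intro h; exact e2 (by rw [← MM_inv hm' v, h, mb'])
        · intro h; exact e1 (by rw [← MM_inv hm' v, h, mx'])
    have haT : a ∈ T := by
      have : a ∈ (T.erase x).erase b := by
        rw [key]; simp [haS, hax, Ne.symm hab]
      exact Finset.mem_of_mem_erase (Finset.mem_of_mem_erase this)
    have hxT := ax haT
    have hbT := xb hxT
    refine Finset.Subset.antisymm hTS ?_
    intro v hv
    by_cases e1 : v = x
    · subst e1; exact hxT
    by_cases e2 : v = b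
    · subst e2; exact hbT
    have : v ∈ (T.erase x).erase b := by rw [key]; simp [e1, e2, hv]
    exact Finset.mem_of_mem_erase (Finset.mem_of_mem_erase this)

lemma not_Ham_edge {S : Finset α} (hS : 3 ≤ S.card) {x a : α} (hx : x ∈ S) (ha : a ∈ S)
    {m m' : Perm α} (h1 : m x = a) (h2 : m a = x) (h3 : m' x = a) (h4 : m' a = x) :
    ¬ Ham S m m' := by
  intro H
  have := H {x, a} (by intro v hv; simp at hv; rcases hv with rfl | rfl <;> assumption) (by simp)
    (by intro v hv; simp at hv; rcases hv with rfl | rfl <;> simp [*])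
    (by intro v hv; simp at hv; rcases hv with rfl | rfl <;> simp [*])
  have h5 : ({x, a} : Finset α).card ≤ 2 := Finset.card_le_two
  rw [this] at h5
  omega

/-- Adjacency operator of the Hamiltonian graph. -/
noncomputable def Ao (S : Finset α) (g : Perm α → ℝ) (m : Perm α) : ℝ :=
  ∑ m' ∈ MM S, if Ham S m m' then g m' else 0

lemma Ao_congr (S : Finset α) (g h : Perm α → ℝ) (H : ∀ m ∈ MM S, g m = h m) (m : Perm α) :
    Ao S g m = Ao S h m := by
  unfold Ao
  exact Finset.sum_congr rfl fun m' hm' => by rw [H m' hm']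

lemma Ao_symm (S : Finset α) (g h : Perm α → ℝ) :
    ∑ m ∈ MM S, g m * Ao S h m = ∑ m ∈ MM S, Ao S g m * h m := by
  unfold Ao
  simp only [Finset.mul_sum, Finset.sum_mul]
  rw [Finset.sum_comm]
  refine Finset.sum_congr rfl fun m _ => Finset.sum_congr rfl fun m' _ => ?_
  rw [Ham_symm S m m']
  split_ifs <;> simp

lemma Ao_block {S : Finset α} (hS : 3 ≤ S.card) {x a : α} (hx : x ∈ S) (ha : a ∈ S.erase x)
    {m : Perm α} (hm : m ∈ MM ((S.erase x).erase a)) (g : Perm α → ℝ) :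
    Ao S g (m * swap a x) = ∑ b ∈ (S.erase x).erase a,
      Ao ((S.erase x).erase b) (fun m' => g (m' * swap b x)) (cj a b m) := by
  conv_lhs => unfold Ao
  rw [sum_vertex hx, ← Finset.add_sum_erase _ _ ha]
  have e1 : ∑ m' ∈ MM ((S.erase x).erase a),
      (if Ham S (m * swap a x) (m' * swap a x) then g (m' * swap a x) else 0) = 0 := by
    refine Finset.sum_eq_zero fun m' hm' => ?_
    rw [if_neg]
    apply not_Ham_edge hS hx (Finset.mem_of_mem_erase ha)
    · simp [MM_fix hm (show a ∉ _ by simp)]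
    · simp [MM_fix hm (show x ∉ _ by simp)]
    · simp [MM_fix hm' (show a ∉ _ by simp)]
    · simp [MM_fix hm' (show x ∉ _ by simp)]
  rw [e1, zero_add]
  refine Finset.sum_congr rfl fun b hb => ?_
  unfold Ao
  refine Finset.sum_congr rfl fun m' hm' => ?_
  obtain ⟨hb1, hb2⟩ := Finset.mem_erase.1 hb
  simp only [Ham_rec hx ha hb2 hb1 hm hm']

def dg : ℕ → ℝ
  | 0 => 1
  | (k + 1) => 2 * (k + 1) * dg k

lemma dg_pos (k : ℕ) : 0 < dg k := by
  induction k with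
  | zero => simp [dg]
  | succ k ih => simp only [dg]; positivity

lemma MM_split {S : Finset α} {x : α} (hx : x ∈ S) {m : Perm α} (hm : m ∈ MM S) :
    m x ∈ S.erase x ∧ m * swap (m x) x ∈ MM ((S.erase x).erase (m x)) ∧
      (m * swap (m x) x) * swap (m x) x = m := by
  have h : m x ∈ S.erase x := Finset.mem_erase.2 ⟨MM_ne hm hx, MM_mem hm hx⟩
  exact ⟨h, MM_del hx h hm rfl, by simp [mul_assoc]⟩

lemma Ao_one (k : ℕ) : ∀ (S : Finset α), S.card = 2 * (k + 1) → ∀ m ∈ MM S,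
    Ao S (fun _ => 1) m = dg k := by
  induction k with
  | zero =>
    intro S hS m hm
    have : ∀ m' ∈ MM S, Ham S m m' := by
      intro m' _ T hTS hTn h1 _
      obtain ⟨v, hv⟩ := hTn
      refine Finset.eq_of_subset_of_card_le hTS ?_
      rw [hS]
      have h2 : ({m v, v} : Finset α) ⊆ T := by
        intro w hw
        simp at hw
        rcases hw with rfl | rfl
        · exact h1 v hv
        · exact hv
      have := Finset.card_le_card h2
      rwa [Finset.card_pair (MM_ne hm (hTS hv))] at this
    unfold Ao
    rw [Finset.sum_congr rfl fun m' hm' => if_pos (this m' hm'), card_MM 1 S hS]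
    simp [mu, dg]
  | succ k ih =>
    intro S hS m hm
    obtain ⟨x, hx⟩ : S.Nonempty := Finset.card_pos.1 (by omega)
    obtain ⟨ha, h1, h2⟩ := MM_split hx hm
    rw [← h2, Ao_block (by omega) hx ha h1]
    have : ∀ b ∈ (S.erase x).erase (m x), Ao ((S.erase x).erase b) (fun _ => (1 : ℝ))
        (cj (m x) b (m * swap (m x) x)) = dg k := by
      intro b hb
      have hb' := (Finset.mem_erase.1 hb).2
      exact ih _ (card_two (by omega) hx hb') _ (cj_mem ha hb' h1)
    rw [Finset.sum_congr rfl this, Finset.sum_const, card_two (n := 2 * (k + 1)) (by omega) hx ha]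
    simp only [dg, nsmul_eq_mul]
    push_cast; ring

lemma Ao_edge (k : ℕ) (S : Finset α) (hS : S.card = 2 * (k + 2)) (m : Perm α) (hm : m ∈ MM S)
    (y z : α) (hy : y ∈ S) (hz : z ∈ S) (hyz : z ≠ y) :
    Ao S (fun m' => if m' y = z then 1 else 0) m = dg k * (1 - if m y = z then 1 else 0) := by
  obtain ⟨ha, h1, h2⟩ := MM_split hy hm
  conv_lhs => rw [← h2]
  rw [Ao_block (by omega) hy ha h1]
  have : ∀ b ∈ (S.erase y).erase (m y), Ao ((S.erase y).erase b)
      (fun m' => if (m' * swap b y) y = z then (1 : ℝ) else 0)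
        (cj (m y) b (m * swap (m y) y)) = if z = b then dg k else 0 := by
    intro b hb
    have hb' := (Finset.mem_erase.1 hb).2
    have e : ∀ m' ∈ MM ((S.erase y).erase b),
        (if (m' * swap b y) y = z then (1 : ℝ) else 0) = if z = b then 1 else 0 := by
      intro m' hm'
      have : (m' * swap b y) y = b := by simp [MM_fix hm' (show b ∉ _ by simp)]
      rw [this]; simp only [eq_comm]
    rw [Ao_congr _ _ _ e]
    by_cases hzb : z = b
    · simp only [hzb, if_true]
      exact Ao_one k _ (card_two (by omega) hy hb') _ (cj_mem ha hb' h1)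
    · simp [hzb, Ao]
  rw [Finset.sum_congr rfl this, Finset.sum_ite_eq]
  by_cases h : m y = z
  · simp [h]
  · simp [h, Ne.symm h, hyz, hz]

lemma Ao_ue (k : ℕ) (S : Finset α) (hS : S.card = 2 * (k + 2)) (g : Perm α → ℝ)
    (hg : ∑ m ∈ MM S, g m = 0) (m : Perm α) (hm : m ∈ MM S) :
    Ao S (ue S g) m = - dg k * ue S g m := by
  have e : ∀ m' ∈ MM S, ue S g m'
      = ∑ y ∈ S, ∑ z ∈ S, pe S g y z * (if m' y = z then 1 else 0) := by
    intro m' hm'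
    unfold ue
    refine Finset.sum_congr rfl fun y hy => ?_
    simp only [mul_ite, mul_zero, mul_one]
    rw [Finset.sum_ite_eq, if_pos (MM_mem hm' hy)]
  have e1 : Ao S (ue S g) m = ∑ y ∈ S, ∑ z ∈ S, pe S g y z *
      Ao S (fun m' => if m' y = z then 1 else 0) m := by
    rw [Ao_congr S _ _ e]
    unfold Ao
    simp only [Finset.mul_sum]
    have : ∀ m' ∈ MM S, (if Ham S m m' then
        ∑ y ∈ S, ∑ z ∈ S, pe S g y z * (if m' y = z then 1 else 0) else 0)
        = ∑ y ∈ S, ∑ z ∈ S, pe S g y z * (if Ham S m m' then (if m' y = z then 1 else 0) else 0) := by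
      intro m' _; split_ifs <;> simp
    rw [Finset.sum_congr rfl this, Finset.sum_comm]
    exact Finset.sum_congr rfl fun y _ => Finset.sum_comm
  rw [e1, e m hm, Finset.mul_sum]
  refine Finset.sum_congr rfl fun y hy => ?_
  have e2 : ∀ z ∈ S, pe S g y z * Ao S (fun m' => if m' y = z then 1 else 0) m
      = dg k * pe S g y z - dg k * (pe S g y z * (if m y = z then 1 else 0)) := by
    intro z hz
    by_cases hyz : z = y
    · subst hyz; rw [pe_diag S g hg]; simp
    · rw [Ao_edge k S hS m hm y z hy hz hyz]; ring
  rw [Finset.sum_congr rfl e2, Finset.sum_sub_distrib, ← Finset.mul_sum, pe_sum S S le_rfl g hg,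
    ← Finset.mul_sum]
  ring

lemma Ao_sum (k : ℕ) (S : Finset α) (hS : S.card = 2 * (k + 1)) (g : Perm α → ℝ) :
    ∑ m ∈ MM S, Ao S g m = dg k * ∑ m ∈ MM S, g m := by
  have := Ao_symm S (fun _ => 1) g
  simp only [one_mul] at this
  rw [this, Finset.mul_sum]
  exact Finset.sum_congr rfl fun m hm => by rw [Ao_one k S hS m hm]

/-- bound for the nontrivial eigenvalues -/
def kp : ℕ → ℝ
  | 0 => 1
  | (k + 1) => dg k

lemma Ao_lin (S : Finset α) (c d : ℝ) (g h : Perm α → ℝ) (m : Perm α) :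
    Ao S (fun m => c * g m + d * h m) m = c * Ao S g m + d * Ao S h m := by
  unfold Ao
  rw [Finset.mul_sum, Finset.mul_sum, ← Finset.sum_add_distrib]
  refine Finset.sum_congr rfl fun m' _ => ?_
  split_ifs <;> simp

lemma Ao_norm (k : ℕ) : ∀ (S : Finset α), S.card = 2 * (k + 1) → ∀ g : Perm α → ℝ,
    ∑ m ∈ MM S, g m = 0 →
    ∑ m ∈ MM S, Ao S g m ^ 2 ≤ kp k ^ 2 * ∑ m ∈ MM S, g m ^ 2 := by
  induction k with
  | zero =>
    intro S hS g hg
    have h2 : (MM S).card = 1 := by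
      have h1 := card_MM 1 S hS
      have : ((MM S).card : ℝ) = 1 := by simpa [mu] using h1
      exact_mod_cast this
    obtain ⟨p, hp⟩ := Finset.card_eq_one.1 h2
    rw [hp, Finset.sum_singleton] at hg
    rw [hp, Finset.sum_singleton, Finset.sum_singleton]
    unfold Ao
    rw [hp, Finset.sum_singleton, hg]
    simp
  | succ k ih =>
    intro S hS g hg
    obtain ⟨u, w, h1, h2, h3, h4, -⟩ := exists_decomp k S hS g hg
    have hu : ∀ m ∈ MM S, Ao S u m = - dg k * u m := by
      intro m hm
      have : u = fun m => (1 / (4 * (k + 1) * mu k)) * ue S g m + 0 * ue S g m := by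
        funext m; rw [h2 m]; ring
      rw [this, Ao_lin, Ao_ue k S hS g hg m hm]; ring
    -- bound on w
    have hw : ∑ m ∈ MM S, Ao S w m ^ 2 ≤ dg k ^ 2 * ∑ m ∈ MM S, w m ^ 2 := by
      obtain ⟨x, hx⟩ : S.Nonempty := Finset.card_pos.1 (by omega)
      set S' := S.erase x with hS'
      have cS' : S'.card = 2 * (k + 1) + 1 := by
        rw [hS', Finset.card_erase_of_mem hx]; omega
      set f : α → Perm α → ℝ := fun b m => w (m * swap b x) with hf
      set h : α → Perm α → ℝ := fun b m => Ao (S'.erase b) (f b) m with hh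
      have cb : ∀ b ∈ S', (S'.erase b).card = 2 * (k + 1) := by
        intro b hb; rw [Finset.card_erase_of_mem hb]; omega
      have f0 : ∀ b ∈ S', ∑ m ∈ MM (S'.erase b), f b m = 0 := by
        intro b hb
        have := h3 x hx b (Finset.mem_of_mem_erase hb)
        unfold pe at this
        rwa [sum_edge hx hb] at this
      have hh0 : ∀ b ∈ S', ∑ m ∈ MM (S'.erase b), h b m = 0 := by
        intro b hb
        rw [hh, Ao_sum k _ (cb b hb), f0 b hb, mul_zero]
      have e1 : ∑ m ∈ MM S, Ao S w m ^ 2 = ip S' (Jo S' h) (Jo S' h) := by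
        rw [sum_vertex hx]
        unfold ip
        refine Finset.sum_congr rfl fun a ha => Finset.sum_congr rfl fun m hm => ?_
        rw [Ao_block (by omega) hx ha hm, sq]
        rfl
      have e2 : ∑ m ∈ MM S, w m ^ 2 = ip S' f f := by
        rw [sum_vertex hx]
        unfold ip
        refine Finset.sum_congr rfl fun a ha => Finset.sum_congr rfl fun m hm => ?_
        rw [sq]
      have e3 : ip S' h h ≤ kp k ^ 2 * ip S' f f := by
        unfold ip
        rw [Finset.mul_sum]
        refine Finset.sum_le_sum fun b hb => ?_
        simp only [← sq]
        exact ih _ (cb b hb) (f b) (f0 b hb)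
      obtain ⟨c, hc1, hc2, hc3⟩ : ∃ c : ℝ, (k : ℝ) + 1 ≤ c ∧ 2 * (k : ℝ) ≤ c ∧ c * kp k = dg k := by
        cases k with
        | zero => exact ⟨1, by simp, by simp, by simp [kp, dg]⟩
        | succ j =>
          refine ⟨2 * (j + 1), ?_, ?_, ?_⟩
          · push_cast
            have : (0 : ℝ) ≤ j := by positivity
            linarith
          · push_cast; exact le_rfl
          · simp [kp, dg]
      have e4 := J_norm k S' cS' h hh0 c hc1 hc2
      rw [e1, e2, ← hc3, mul_pow]
      refine e4.trans ?_
      rw [mul_assoc]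
      exact mul_le_mul_of_nonneg_left e3 (sq_nonneg c)
    have hcross : ∑ m ∈ MM S, u m * Ao S w m = 0 := by
      rw [Ao_symm, Finset.sum_congr rfl fun m hm => by rw [hu m hm, mul_assoc], ← Finset.mul_sum,
        h4, mul_zero]
    have hgA : ∀ m, Ao S g m = Ao S u m + Ao S w m := by
      intro m
      have := Ao_lin S 1 1 u w m
      rw [one_mul, one_mul] at this
      rw [← this]
      exact Ao_congr _ _ _ (fun m _ => by rw [h1 m]; ring) _
    have e5 : ∑ m ∈ MM S, Ao S g m ^ 2
        = dg k ^ 2 * ∑ m ∈ MM S, u m ^ 2 + ∑ m ∈ MM S, Ao S w m ^ 2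
          - 2 * dg k * ∑ m ∈ MM S, u m * Ao S w m := by
      rw [Finset.mul_sum, Finset.mul_sum, ← Finset.sum_add_distrib, ← Finset.sum_sub_distrib]
      refine Finset.sum_congr rfl fun m hm => ?_
      rw [hgA m, hu m hm]; ring
    have e6 : ∑ m ∈ MM S, g m ^ 2 = ∑ m ∈ MM S, u m ^ 2 + ∑ m ∈ MM S, w m ^ 2
        + 2 * ∑ m ∈ MM S, u m * w m := by
      rw [Finset.mul_sum, ← Finset.sum_add_distrib, ← Finset.sum_add_distrib]
      refine Finset.sum_congr rfl fun m hm => ?_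
      rw [h1 m]; ring
    rw [e5, e6, hcross, h4]
    simp only [kp]
    linarith

/-- The ratio bound. -/
lemma ratio_bound (k : ℕ) (S : Finset α) (hS : S.card = 2 * (k + 2)) (F : Finset (Perm α))
    (hFS : F ⊆ MM S) (hF : ∀ m ∈ F, ∀ m' ∈ F, ¬ Ham S m m') : (F.card : ℝ) ≤ mu (k + 1) := by
  set N := mu (k + 2) with hN
  have hN0 : 0 < N := mu_pos _
  have hd := dg_pos k
  have hcard : ∑ _m ∈ MM S, (1 : ℝ) = N := card_MM (k + 2) S hS
  set o : Perm α → ℝ := fun m => if m ∈ F then 1 else 0 with ho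
  obtain ⟨C, hC⟩ : ∃ C : ℝ, C = (F.card : ℝ) := ⟨_, rfl⟩
  rw [← hC]
  have hC0 : 0 ≤ C := by rw [hC]; positivity
  have so : ∑ m ∈ MM S, o m = C := by
    rw [ho, ← Finset.sum_filter, Finset.filter_mem_eq_inter, Finset.inter_eq_right.2 hFS]; simp [hC]
  have so2 : ∑ m ∈ MM S, o m ^ 2 = C := by
    rw [← so]; refine Finset.sum_congr rfl fun m _ => ?_
    simp only [ho]; split_ifs <;> simp
  set g : Perm α → ℝ := fun m => 1 * o m + (-(C / N)) * 1 with hg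
  have g0 : ∑ m ∈ MM S, g m = 0 := by
    simp only [hg]
    rw [Finset.sum_add_distrib, ← Finset.mul_sum, ← Finset.mul_sum, so, hcard]
    field_simp; ring
  have g2 : ∑ m ∈ MM S, g m ^ 2 = C - C ^ 2 / N := by
    have : ∑ m ∈ MM S, g m ^ 2 = ∑ m ∈ MM S, o m ^ 2 - 2 * (C / N) * ∑ m ∈ MM S, o m
        + (C / N) ^ 2 * ∑ _m ∈ MM S, (1 : ℝ) := by
      rw [Finset.mul_sum, Finset.mul_sum, ← Finset.sum_sub_distrib, ← Finset.sum_add_distrib]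
      refine Finset.sum_congr rfl fun m _ => ?_
      simp only [hg]; ring
    rw [this, so2, so, hcard]; field_simp; ring
  have oAo : ∑ m ∈ MM S, o m * Ao S o m = 0 := by
    refine Finset.sum_eq_zero fun m _ => ?_
    by_cases hm : m ∈ F
    · have : Ao S o m = 0 := by
        refine Finset.sum_eq_zero fun m' _ => ?_
        by_cases hm' : m' ∈ F
        · rw [if_neg (hF m hm m' hm')]
        · simp [ho, hm']
      rw [this, mul_zero]
    · simp [ho, hm]
  have hAg : ∀ m ∈ MM S, Ao S g m = Ao S o m - C / N * dg (k + 1) := by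
    intro m hm
    rw [hg, Ao_lin S 1 (-(C / N)) o (fun _ => 1) m, Ao_one (k + 1) S hS m hm]; ring
  have sAo : ∑ m ∈ MM S, Ao S o m = dg (k + 1) * C := by rw [Ao_sum (k + 1) S hS, so]
  have gAg : ∑ m ∈ MM S, g m * Ao S g m = - (C ^ 2 / N * dg (k + 1)) := by
    have : ∑ m ∈ MM S, g m * Ao S g m = ∑ m ∈ MM S, o m * Ao S o m
        - C / N * ∑ m ∈ MM S, Ao S o m - C / N * dg (k + 1) * ∑ m ∈ MM S, g m := by
      rw [Finset.mul_sum, Finset.mul_sum, ← Finset.sum_sub_distrib, ← Finset.sum_sub_distrib]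
      refine Finset.sum_congr rfl fun m hm => ?_
      rw [hAg m hm]; simp only [hg]; ring
    rw [this, oAo, sAo, g0]; field_simp; ring
  have hn := Ao_norm (k + 1) S hS g g0
  simp only [kp] at hn
  have hp : 0 ≤ ∑ m ∈ MM S, (Ao S g m + dg k * g m) ^ 2 :=
    Finset.sum_nonneg fun m _ => sq_nonneg _
  have hp' : ∑ m ∈ MM S, (Ao S g m + dg k * g m) ^ 2 = ∑ m ∈ MM S, Ao S g m ^ 2
      + 2 * dg k * ∑ m ∈ MM S, g m * Ao S g m + dg k ^ 2 * ∑ m ∈ MM S, g m ^ 2 := by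
    rw [Finset.mul_sum, Finset.mul_sum, ← Finset.sum_add_distrib, ← Finset.sum_add_distrib]
    refine Finset.sum_congr rfl fun m _ => ?_
    ring
  rw [hp', gAg] at hp
  rw [g2] at hn hp
  have h7 : 0 ≤ 2 * dg k * (dg k * (C - C ^ 2 / N) - C ^ 2 / N * dg (k + 1)) := by nlinarith
  have h8 := nonneg_of_mul_nonneg_right h7 (by positivity)
  have h9 : dg k * (C - C ^ 2 / N) - C ^ 2 / N * dg (k + 1)
      = dg k * (C * (1 - C / mu (k + 1))) := by
    have hm1 := mu_pos (k + 1)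
    have : N = (2 * (k + 1) + 1) * mu (k + 1) := by rw [hN]; simp [mu]
    rw [this]; simp only [dg]
    have h3 : (2 * ((k : ℝ) + 1) + 1) ≠ 0 := by positivity
    field_simp
    ring
  rw [h9] at h8
  have h10 := nonneg_of_mul_nonneg_right h8 hd
  by_contra hcon
  push Not at hcon
  have hm1 := mu_pos (k + 1)
  have h11 : 1 < C / mu (k + 1) := by rwa [lt_div_iff₀ hm1, one_mul]
  have h12 : 0 < C := lt_trans hm1 hcon
  nlinarith

end
lemma mu_eq (k : ℕ) : mu (k + 1) = (((2 * k + 1)‼ : ℕ) : ℝ) := by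
  induction k with
  | zero => simp [mu]
  | succ k ih =>
    have : 2 * (k + 1) + 1 = (2 * k + 1) + 2 := by ring
    rw [this, Nat.doubleFactorial_add_two, mu, ih]
    push_cast; ring

lemma pm_mem_MM {N : ℕ} (m : Perm (Fin N)) (h : IsPM m) : m ∈ MM (univ : Finset (Fin N)) := by
  rw [mem_MM]
  exact ⟨h.1, fun v => ⟨fun _ => Finset.mem_univ _, fun _ => h.2 v⟩⟩

lemma mem_MM_pm {N : ℕ} (m : Perm (Fin N)) (h : m ∈ MM (univ : Finset (Fin N))) : IsPM m := by
  rw [mem_MM] at h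
  exact ⟨h.1, fun v => (h.2 v).2 (Finset.mem_univ v)⟩

/-- A Hamiltonian union gives cycle type `{n, n}`. -/
lemma ham_cycleType (n : ℕ) (hn : 2 ≤ n) (m m' : Perm (Fin (2 * n))) (hm : IsPM m) (hm' : IsPM m')
    (h : Ham univ m m') : (m * m').cycleType = ({n, n} : Multiset ℕ) := by
  obtain ⟨p, hp⟩ : ∃ p, p = m * m' := ⟨_, rfl⟩
  rw [← hp]
  have hmm : ∀ v, m (m v) = v := hm.1
  have hmm' : ∀ v, m' (m' v) = v := hm'.1
  have m1 : m⁻¹ = m := by ext v; rw [Perm.inv_eq_iff_eq.2 (hmm v).symm]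
  have m1' : m'⁻¹ = m' := by ext v; rw [Perm.inv_eq_iff_eq.2 (hmm' v).symm]
  have msq : m * m = 1 := by ext v; simp [hmm]
  have msq' : m' * m' = 1 := by ext v; simp [hmm']
  have hpinv : p⁻¹ = m' * m := by rw [hp, mul_inv_rev, m1, m1']
  have hmp : m * p * m⁻¹ = p⁻¹ := by
    rw [hpinv, hp, m1, ← mul_assoc, msq, one_mul]
  have hconj : ∀ (z : ℤ) v, m ((p ^ z) v) = (p ^ (-z)) (m v) := by
    intro z v
    have e : m * p ^ z * m⁻¹ = p ^ (-z) := by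
      rw [← conj_zpow, hmp, inv_zpow, zpow_neg]
    have := congrArg (fun q : Perm _ => q (m v)) e
    simpa using this
  have hm'p : m' = p⁻¹ * m := by rw [hpinv, mul_assoc, msq, mul_one]
  have hpos : 0 < 2 * n := by omega
  let v : Fin (2 * n) := ⟨0, hpos⟩
  have hnot : ¬ p.SameCycle v (m v) := by
    rintro ⟨z, hz⟩
    rcases Int.even_or_odd' z with ⟨j, rfl | rfl⟩
    · refine hm.2 ((p ^ j) v) ?_
      rw [hconj, ← hz, ← Perm.mul_apply, ← zpow_add]
      congr 2; ring
    · refine hm'.2 ((p ^ j) v) ?_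
      rw [hm'p, Perm.mul_apply, hconj, ← hz, ← zpow_neg_one, ← Perm.mul_apply, ← Perm.mul_apply,
        ← zpow_add, ← zpow_add]
      congr 2; ring
  have hsm : ∀ x y, p.SameCycle x y → p.SameCycle (m x) (m y) := by
    rintro x y ⟨z, rfl⟩
    exact ⟨-z, (hconj z x).symm⟩
  have hall : ∀ x, p.SameCycle v x ∨ p.SameCycle (m v) x := by
    have := h (univ.filter fun x => p.SameCycle v x ∨ p.SameCycle (m v) x) (Finset.subset_univ _)
      ⟨v, by simp [Perm.SameCycle.refl]⟩ ?_ ?_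
    · intro x
      have hx : x ∈ (univ : Finset (Fin (2 * n))) := Finset.mem_univ x
      rw [← this] at hx
      simpa using hx
    · intro x hx
      simp only [Finset.mem_filter, Finset.mem_univ, true_and] at hx ⊢
      rcases hx with hx | hx
      · exact Or.inr (hsm _ _ hx)
      · have := hsm _ _ hx
        rw [hmm] at this
        exact Or.inl this
    · intro x hx
      simp only [Finset.mem_filter, Finset.mem_univ, true_and] at hx ⊢
      rw [hm'p]
      have hinv : ∀ a b, p.SameCycle a b → p.SameCycle a ((p⁻¹ * m) (m b)) := by
        intro a b hab
        rw [Perm.mul_apply, hmm]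
        exact hab.trans ⟨-1, by rw [zpow_neg_one]⟩
      have hinv' : ∀ a b, p.SameCycle a (m b) → p.SameCycle a ((p⁻¹ * m) b) := by
        intro a b hab
        have := hinv a (m b) hab
        rwa [hmm] at this
      rcases hx with hx | hx
      · exact Or.inr (hinv' _ _ (hsm _ _ hx))
      · have := hsm _ _ hx
        rw [hmm] at this
        exact Or.inl (hinv' _ _ this)
  set O := univ.filter fun x => p.SameCycle v x with hO
  set O' := univ.filter fun x => p.SameCycle (m v) x with hO'
  have hcard : O.card = O'.card := by
    refine Finset.card_bij (fun x _ => m x) ?_ ?_ ?_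
    · intro x hx
      simp only [hO, hO', Finset.mem_filter, Finset.mem_univ, true_and] at hx ⊢
      exact hsm _ _ hx
    · intro x _ y _ e
      exact m.injective e
    · intro y hy
      simp only [hO, hO', Finset.mem_filter, Finset.mem_univ, true_and] at hy ⊢
      refine ⟨m y, ?_, hmm y⟩
      have := hsm _ _ hy
      rwa [hmm] at this
  have hdis : Disjoint O O' := by
    rw [Finset.disjoint_left]
    intro x hx hx'
    simp only [hO, hO', Finset.mem_filter, Finset.mem_univ, true_and] at hx hx'
    exact hnot (hx.trans hx'.symm)
  have hun : O ∪ O' = univ := by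
    ext x
    simp only [hO, hO', Finset.mem_union, Finset.mem_filter, Finset.mem_univ, true_and, iff_true]
    exact hall x
  have hsum : O.card + O'.card = 2 * n := by
    rw [← Finset.card_union_of_disjoint hdis, hun]; simp
  have hOn : O.card = n := by omega
  have hOn' : O'.card = n := by omega
  have key : ∀ w, (univ.filter fun x => p.SameCycle w x).card = n →
      p w ≠ w ∧ (p.cycleOf w).support = univ.filter fun x => p.SameCycle w x := by
    intro w hw
    have hne : p w ≠ w := by
      intro hfix
      have hle : (univ.filter fun x => p.SameCycle w x) ⊆ {w} := by
        intro x hx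
        simp only [Finset.mem_filter, Finset.mem_univ, true_and] at hx
        rw [Finset.mem_singleton]
        exact (hx.eq_of_left hfix).symm
      have := Finset.card_le_card hle
      rw [hw, Finset.card_singleton] at this
      omega
    refine ⟨hne, ?_⟩
    ext x
    rw [Perm.mem_support_cycleOf_iff' hne]
    simp
  obtain ⟨hv, sv⟩ := key v hOn
  obtain ⟨hv', sv'⟩ := key (m v) hOn'
  have hd : (p.cycleOf v).Disjoint (p.cycleOf (m v)) := by
    rw [Perm.disjoint_iff_disjoint_support, sv, sv']
    exact hdis
  have hprod : p = p.cycleOf v * p.cycleOf (m v) := by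
    ext x
    congr 1
    rw [Perm.mul_apply]
    rcases hall x with hx | hx
    · have hx' : ¬ p.SameCycle (m v) x := fun h' => hnot (hx.trans h'.symm)
      rw [Perm.cycleOf_apply_of_not_sameCycle hx', hx.cycleOf_apply]
    · have h1 : p.SameCycle (m v) (p x) := by simpa using hx
      have hx' : ¬ p.SameCycle v (p x) := fun h' => hnot (h'.trans h1.symm)
      rw [hx.cycleOf_apply, Perm.cycleOf_apply_of_not_sameCycle hx']
  have hct : p.cycleType = (p.cycleOf v * p.cycleOf (m v)).cycleType := congrArg _ hprod
  rw [hct, hd.cycleType_mul, (Perm.isCycle_cycleOf p hv).cycleType,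
    (Perm.isCycle_cycleOf p hv').cycleType, sv, sv', ← hO, ← hO', hOn, hOn']
  rfl

end NH

/-- If `F` is a non-Hamiltonian family of perfect matchings of `K_{2n}` — no two members
union to a Hamiltonian cycle `C_{2n}`, i.e. for no `m, m' ∈ F` does the permutation
`m * m'` consist of two `n`-cycles — then `|F| ≤ (2(n-1)-1)!!`, and the bound is
attained by every family `F_{ij}` of all matchings through a fixed edge `{i,j}`
(such a family is non-Hamiltonian and has size exactly `(2(n-1)-1)!!`). -/
theorem nonHamiltonian_bound (n : ℕ) (hn : 2 ≤ n) (F : Finset (PMV n))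
    (hF : ∀ m ∈ F, ∀ m' ∈ F, (m.1 * m'.1).cycleType ≠ ({n, n} : Multiset ℕ)) :
    F.card ≤ (2 * (n - 1) - 1)‼ ∧
    ∀ i j : Fin (2 * n), i ≠ j →
      (∀ m ∈ Finset.univ.filter (fun m : PMV n => m.1 i = j),
        ∀ m' ∈ Finset.univ.filter (fun m : PMV n => m.1 i = j),
          (m.1 * m'.1).cycleType ≠ ({n, n} : Multiset ℕ)) ∧
      (Finset.univ.filter (fun m : PMV n => m.1 i = j)).card = (2 * (n - 1) - 1)‼ := by
  obtain ⟨k, rfl⟩ : ∃ k, n = k + 2 := ⟨n - 2, by omega⟩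
  have hdf : 2 * (k + 2 - 1) - 1 = 2 * k + 1 := by omega
  have hcu : (Finset.univ : Finset (Fin (2 * (k + 2)))).card = 2 * (k + 2) := by simp
  rw [hdf]
  refine ⟨?_, ?_⟩
  · have hr := NH.ratio_bound k (Finset.univ : Finset (Fin (2 * (k + 2)))) hcu
      (F.map (Function.Embedding.subtype _)) ?_ ?_
    · rw [NH.mu_eq, Finset.card_map] at hr
      exact_mod_cast hr
    · intro m hm
      obtain ⟨x, _, rfl⟩ := Finset.mem_map.1 hm
      exact NH.pm_mem_MM _ x.2
    · intro m hm m' hm' hH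
      obtain ⟨x, hx, rfl⟩ := Finset.mem_map.1 hm
      obtain ⟨y, hy, rfl⟩ := Finset.mem_map.1 hm'
      exact hF x hx y hy (NH.ham_cycleType (k + 2) hn x.1 y.1 x.2 y.2 hH)
  · intro i j hij
    refine ⟨?_, ?_⟩
    · intro m hm m' hm' hc
      rw [Finset.mem_filter] at hm hm'
      have hfix : (m.1 * m'.1) i = i := by
        rw [Equiv.Perm.mul_apply, hm'.2, ← hm.2]
        exact m.2.1 i
      have hs := Equiv.Perm.sum_cycleType (m.1 * m'.1)
      rw [hc] at hs
      have hlt : (m.1 * m'.1).support.card < (Finset.univ : Finset (Fin (2 * (k + 2)))).card := by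
        refine Finset.card_lt_card ⟨Finset.subset_univ _, fun hsub => ?_⟩
        exact Equiv.Perm.mem_support.1 (hsub (Finset.mem_univ i)) hfix
      rw [hcu, ← hs] at hlt
      simp at hlt
      omega
    · have hjm : j ∈ (Finset.univ : Finset (Fin (2 * (k + 2)))).erase i := by
        simp [hij.symm]
      have h1 := NH.sum_edge (Finset.mem_univ i) hjm (fun _ => (1 : ℝ))
      have h2 := NH.card_MM (k + 1)
        (((Finset.univ : Finset (Fin (2 * (k + 2)))).erase i).erase j) (by
          rw [Finset.card_erase_of_mem hjm, Finset.card_erase_of_mem (Finset.mem_univ i), hcu]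
          omega)
      rw [h2, NH.mu_eq, ← Finset.sum_filter, Finset.sum_const, nsmul_eq_mul, mul_one] at h1
      have h3 : ((NH.MM (Finset.univ : Finset (Fin (2 * (k + 2))))).filter
          (fun m => m i = j)).card = (2 * k + 1)‼ := by exact_mod_cast h1
      rw [← h3]
      refine Finset.card_bij (fun m _ => m.1) ?_ ?_ ?_
      · intro m hm
        rw [Finset.mem_filter] at hm ⊢
        exact ⟨NH.pm_mem_MM _ m.2, hm.2⟩
      · intro a _ b _ e
        exact Subtype.ext e
      · intro m hm
        rw [Finset.mem_filter] at hm
        exact ⟨⟨m, NH.mem_MM_pm m hm.1⟩, by simpa using hm.2, rfl⟩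
end

section
/- The perfect matching polytope of K_{2n} (the convex hull in R^{E(K_{2n})} of the incidence vectors of all perfect matchings) has dimension C(2n,2) - 2n for n ≥ 2; equivalently, the maximum number of perfect matchings of K_{2n} with linearly independent incidence vectors over R is C(2n,2) - 2n + 1. -/
open scoped Classical

/-- The incidence vector in `ℝ^{E(K_{2n})}` of a perfect matching: the coordinate of
an edge `e` is `1` iff `e` is an edge of the matching. -/
noncomputable def inc (n : ℕ) (m : PMV n) : Sym2 (Fin (2 * n)) → ℝ :=
  fun e => if ∃ a, e = s(a, m.1 a) then 1 else 0

theorem pm_exists (n : ℕ) : Nonempty (PMV n) := by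
  let e : Fin 2 × Fin n ≃ Fin (2 * n) := finProdFinEquiv
  let g : Equiv.Perm (Fin 2 × Fin n) := Equiv.prodCongr (Equiv.swap 0 1) (Equiv.refl _)
  have hg : ∀ x, g (g x) = x := by
    rintro ⟨x, y⟩; simp [g]
  have hg' : ∀ x, g x ≠ x := by
    rintro ⟨x, y⟩ h
    have := congrArg Prod.fst h
    simp only [g, Equiv.prodCongr_apply, Prod.map] at this
    revert this
    fin_cases x <;> simp
  refine ⟨⟨(e.symm.trans g).trans e, ?_, ?_⟩⟩
  · intro x; simp [hg]
  · intro x h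
    apply hg' (e.symm x)
    apply e.injective
    simpa using h

/-- Conjugate of a perfect matching by a transposition. -/
noncomputable def pmConj {n : ℕ} (m : PMV n) (b c : Fin (2 * n)) : PMV n :=
  ⟨((Equiv.swap b c).trans m.1).trans (Equiv.swap b c), by
    constructor
    · intro x; simp [m.2.1 _]
    · intro x h
      apply m.2.2 (Equiv.swap b c x)
      apply (Equiv.swap b c).injective
      simpa using h⟩

theorem pmConj_apply {n : ℕ} (m : PMV n) (b c x : Fin (2 * n)) :
    (pmConj m b c).1 x = Equiv.swap b c (m.1 (Equiv.swap b c x)) := rfl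

theorem pm_one {n : ℕ} (m : PMV n) (a b : Fin (2 * n)) (hab : a ≠ b) :
    (pmConj m (m.1 a) b).1 a = b := by
  rw [pmConj_apply, Equiv.swap_apply_of_ne_of_ne (m.2.2 a).symm hab, Equiv.swap_apply_left]

theorem pm_two {n : ℕ} (a b c d : Fin (2 * n)) (hab : a ≠ b) (hac : a ≠ c) (had : a ≠ d)
    (hbc : b ≠ c) (hbd : b ≠ d) (hcd : c ≠ d) :
    ∃ m : PMV n, m.1 a = b ∧ m.1 c = d := by
  obtain ⟨m0⟩ := pm_exists n
  obtain ⟨m, hm⟩ : ∃ m : PMV n, m.1 a = b := ⟨_, pm_one m0 a b hab⟩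
  have hm' : m.1 b = a := by rw [← hm]; exact m.2.1 a
  refine ⟨pmConj m (m.1 c) d, ?_, pm_one m c d hcd⟩
  have h1 : a ≠ m.1 c := by
    intro h; rw [← hm'] at h; exact hbc (m.1.injective h)
  have h2 : b ≠ m.1 c := by
    intro h; rw [← hm] at h; exact hac (m.1.injective h)
  rw [pmConj_apply, Equiv.swap_apply_of_ne_of_ne h1 had, hm,
    Equiv.swap_apply_of_ne_of_ne h2 hbd]

theorem sum_inc {n : ℕ} (m : PMV n) (w : Sym2 (Fin (2 * n)) → ℝ) :
    ∑ a, w s(a, m.1 a) = 2 * ∑ e, inc n m e * w e := by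
  rw [← Finset.sum_fiberwise (s := Finset.univ) (g := fun a => s(a, m.1 a)), Finset.mul_sum]
  refine Finset.sum_congr rfl fun e _ => ?_
  have h1 : ∑ a with s(a, m.1 a) = e, w s(a, m.1 a) = ∑ a with s(a, m.1 a) = e, w e := by
    refine Finset.sum_congr rfl fun a ha => ?_
    rw [(Finset.mem_filter.1 ha).2]
  rw [h1, Finset.sum_const, nsmul_eq_mul, ← mul_assoc]
  congr 1
  unfold inc
  split_ifs with h
  · obtain ⟨a0, rfl⟩ := h
    have : (Finset.univ.filter fun a => s(a, m.1 a) = s(a0, m.1 a0)) = {a0, m.1 a0} := by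
      ext a
      simp only [Finset.mem_filter, Finset.mem_univ, true_and, Finset.mem_insert,
        Finset.mem_singleton, Sym2.eq_iff]
      constructor
      · rintro (h | h)
        · exact Or.inl h.1
        · exact Or.inr h.1
      · rintro (rfl | rfl)
        · exact Or.inl ⟨rfl, rfl⟩
        · exact Or.inr ⟨rfl, m.2.1 _⟩
    rw [this, Finset.card_pair (m.2.2 a0).symm]; norm_num
  · have : (Finset.univ.filter fun a => s(a, m.1 a) = e) = ∅ := by
      ext a
      simp only [Finset.mem_filter, Finset.mem_univ, true_and, Finset.notMem_empty, iff_false]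
      intro h'; exact h ⟨a, h'.symm⟩
    rw [this]; simp

theorem four_term {n : ℕ} (w : Sym2 (Fin (2 * n)) → ℝ)
    (hw : ∀ m : PMV n, ∑ a, w s(a, m.1 a) = 0)
    (a b c d : Fin (2 * n)) (hab : a ≠ b) (hac : a ≠ c) (had : a ≠ d)
    (hbc : b ≠ c) (hbd : b ≠ d) (hcd : c ≠ d) :
    w s(a, b) + w s(c, d) = w s(a, c) + w s(b, d) := by
  obtain ⟨m, h1, h2⟩ := pm_two a b c d hab hac had hbc hbd hcd
  have h1' : m.1 b = a := by rw [← h1]; exact m.2.1 a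
  have h2' : m.1 d = c := by rw [← h2]; exact m.2.1 c
  have e1 := hw m
  have e2 := hw (pmConj m b c)
  rw [← Equiv.sum_comp (Equiv.swap b c)] at e2
  simp only [pmConj_apply, Equiv.swap_apply_self] at e2
  have e3 : ∑ x, (w s(x, m.1 x) - w s(Equiv.swap b c x, Equiv.swap b c (m.1 x))) = 0 := by
    rw [Finset.sum_sub_distrib, e1, e2, sub_zero]
  rw [← Finset.sum_subset (Finset.subset_univ ({a, b, c, d} : Finset (Fin (2 * n))))] at e3
  · rw [Finset.sum_insert (by simp [*]), Finset.sum_insert (by simp [*]),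
      Finset.sum_insert (by simp [*]), Finset.sum_singleton, h1, h1', h2, h2',
      Equiv.swap_apply_left, Equiv.swap_apply_right,
      Equiv.swap_apply_of_ne_of_ne hab hac, Equiv.swap_apply_of_ne_of_ne hbd.symm hcd.symm,
      Sym2.eq_swap (a := b) (b := a), Sym2.eq_swap (a := d) (b := c),
      Sym2.eq_swap (a := c) (b := a), Sym2.eq_swap (a := d) (b := b)] at e3
    linarith
  · intro x _ hx
    simp only [Finset.mem_insert, Finset.mem_singleton, not_or] at hx
    obtain ⟨xa, xb, xc, xd⟩ := hx
    have q1 : m.1 x ≠ b := by rw [← h1]; exact fun h => xa (m.1.injective h)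
    have q2 : m.1 x ≠ c := by rw [← h2']; exact fun h => xd (m.1.injective h)
    rw [Equiv.swap_apply_of_ne_of_ne xb xc, Equiv.swap_apply_of_ne_of_ne q1 q2, sub_self]

theorem exists_pot {V : Type*} (w : Sym2 V → ℝ) (o i j : V) (hoi : o ≠ i) (hoj : o ≠ j)
    (hij : i ≠ j)
    (h4 : ∀ a b c d : V, a ≠ b → a ≠ c → a ≠ d → b ≠ c → b ≠ d → c ≠ d →
      w s(a, b) + w s(c, d) = w s(a, c) + w s(b, d)) :
    ∃ p : V → ℝ, ∀ u v, u ≠ v → w s(u, v) = p u + p v := by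
  have sw : ∀ u v, w s(u, v) = w s(v, u) := fun u v => by rw [Sym2.eq_swap]
  let T : V → V → ℝ := fun u v => w s(o, u) + w s(o, v) - w s(u, v)
  have Ts : ∀ u v, T u v = T v u := fun u v => by simp only [T]; rw [sw u v]; ring
  have Tc : ∀ u v v', o ≠ u → o ≠ v → o ≠ v' → u ≠ v → u ≠ v' → T u v = T u v' := by
    intro u v v' h1 h2 h3 h5 h6
    by_cases h : v = v'
    · rw [h]
    have := h4 o v v' u h2 h3 h1 h h5.symm h6.symm
    simp only [T]
    rw [sw u v, sw u v']
    linarith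
  have TT : ∀ u v, o ≠ u → o ≠ v → u ≠ v → T u v = T i j := by
    intro u v h1 h2 h3
    by_cases h : u = j
    · subst h
      rw [Tc u v i h1 h2 hoi h3 hij.symm, Ts]
    · rw [Tc u v j h1 h2 hoj h3 h, Ts, Tc j u i hoj h1 hoi (Ne.symm h) hij.symm, Ts]
  refine ⟨fun u => if u = o then T i j / 2 else w s(o, u) - T i j / 2, ?_⟩
  intro u v huv
  by_cases hu : u = o
  · subst hu
    simp [huv.symm]
  · by_cases hv : v = o
    · subst hv
      simp [hu, sw u v]
    · have := TT u v (Ne.symm hu) (Ne.symm hv) huv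
      simp only [hu, hv, if_false]
      have h' : T u v = w s(o, u) + w s(o, v) - w s(u, v) := rfl
      linarith

/-- Parametrization of the orthogonal complement. -/
noncomputable def Phi (V : Type*) : (V → ℝ) × (V → ℝ) →ₗ[ℝ] (Sym2 V → ℝ) where
  toFun q := Sym2.lift ⟨fun u v => q.2 u + q.2 v + if u = v then q.1 u else 0, by
    intro u v
    by_cases h : u = v
    · subst h; rfl
    · simp [h, Ne.symm h, add_comm]⟩
  map_add' q r := by
    ext e
    induction e using Sym2.ind with
    | _ u v =>
      simp only [Sym2.lift_mk, Pi.add_apply, Prod.fst_add, Prod.snd_add]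
      split_ifs <;> ring
  map_smul' t q := by
    ext e
    induction e using Sym2.ind with
    | _ u v =>
      simp only [Sym2.lift_mk, Pi.smul_apply, Prod.smul_fst, Prod.smul_snd, smul_eq_mul,
        RingHom.id_apply]
      split_ifs <;> ring

theorem Phi_apply {V : Type*} (q : (V → ℝ) × (V → ℝ)) (u v : V) :
    Phi V q s(u, v) = q.2 u + q.2 v + if u = v then q.1 u else 0 := rfl

theorem three {n : ℕ} (hn : 2 ≤ n) (u : Fin (2 * n)) :
    ∃ i j : Fin (2 * n), u ≠ i ∧ u ≠ j ∧ i ≠ j := by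
  have : 2 < Fintype.card (Fin (2 * n)) := by simp; omega
  have h : 1 < (Finset.univ.erase u).card := by
    rw [Finset.card_erase_of_mem (Finset.mem_univ _), Finset.card_univ]; omega
  obtain ⟨i, hi, j, hj, hij⟩ := Finset.one_lt_card.1 h
  exact ⟨i, j, (Finset.ne_of_mem_erase hi).symm, (Finset.ne_of_mem_erase hj).symm, hij⟩

theorem Phi_inj {n : ℕ} (hn : 2 ≤ n) : Function.Injective (Phi (Fin (2 * n))) := by
  rw [injective_iff_map_eq_zero]
  rintro ⟨d, p⟩ h
  have key : ∀ u v, u ≠ v → p u + p v = 0 := by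
    intro u v huv
    have := congrFun h s(u, v)
    rw [Phi_apply] at this
    simpa [huv] using this
  have hp : ∀ u, p u = 0 := by
    intro u
    obtain ⟨i, j, h1, h2, h3⟩ := three hn u
    have := key u i h1
    have := key u j h2
    have := key i j h3
    linarith
  have hd : ∀ u, d u = 0 := by
    intro u
    have := congrFun h s(u, u)
    rw [Phi_apply] at this
    simpa [hp] using this
  ext u
  · exact hd u
  · exact hp u

/-- Sum of the second coordinate. -/
noncomputable def sumSnd (V : Type*) [Fintype V] : (V → ℝ) × (V → ℝ) →ₗ[ℝ] ℝ where
  toFun q := ∑ v, q.2 v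
  map_add' q r := by simp [Finset.sum_add_distrib]
  map_smul' t q := by simp [Finset.mul_sum]

theorem finrank_ker_sumSnd {n : ℕ} (hn : 2 ≤ n) :
    Module.finrank ℝ (LinearMap.ker (sumSnd (Fin (2 * n)))) + 1 = 4 * n := by
  have h := LinearMap.finrank_range_add_finrank_ker (sumSnd (Fin (2 * n)))
  have hs : LinearMap.range (sumSnd (Fin (2 * n))) = ⊤ := by
    rw [LinearMap.range_eq_top]
    intro t
    refine ⟨(0, Pi.single ⟨0, by omega⟩ t), ?_⟩
    change ∑ v, (Pi.single (⟨0, by omega⟩ : Fin (2 * n)) t : Fin (2 * n) → ℝ) v = t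
    rw [Finset.sum_pi_single']
    simp
  rw [hs, finrank_top, Module.finrank_self, Module.finrank_prod, Module.finrank_fin_fun] at h
  omega

theorem ker_eq {n : ℕ} (hn : 2 ≤ n) :
    LinearMap.ker (Matrix.of (inc n)).mulVecLin =
      (LinearMap.ker (sumSnd (Fin (2 * n)))).map (Phi (Fin (2 * n))) := by
  have hmem : ∀ w, w ∈ LinearMap.ker (Matrix.of (inc n)).mulVecLin ↔
      ∀ m : PMV n, ∑ a, w s(a, m.1 a) = 0 := by
    intro w
    rw [LinearMap.mem_ker, Matrix.mulVecLin_apply, funext_iff]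
    refine forall_congr' fun m => ?_
    rw [sum_inc]
    simp [Matrix.mulVec, dotProduct]
  have hsum : ∀ (m : PMV n) (p : Fin (2 * n) → ℝ), ∑ a, (p a + p (m.1 a)) = 2 * ∑ a, p a := by
    intro m p
    rw [Finset.sum_add_distrib, Equiv.sum_comp m.1 p]; ring
  ext w
  rw [hmem, Submodule.mem_map]
  constructor
  · intro hw
    obtain ⟨i, j, h1, h2, h3⟩ := three hn ⟨0, by omega⟩
    obtain ⟨p, hp⟩ := exists_pot w _ i j h1 h2 h3 (four_term w hw)
    refine ⟨(fun u => w s(u, u) - 2 * p u, p), ?_, ?_⟩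
    · rw [LinearMap.mem_ker]
      change ∑ v, p v = 0
      obtain ⟨m⟩ := pm_exists n
      have := hw m
      rw [Finset.sum_congr rfl fun a _ => hp a (m.1 a) (m.2.2 a).symm, hsum] at this
      linarith
    · ext e
      induction e using Sym2.ind with
      | _ u v =>
        rw [Phi_apply]
        by_cases h : u = v
        · subst h; simp; ring
        · simp [h, hp u v h]
  · rintro ⟨⟨d, p⟩, hq, rfl⟩ m
    have hq' : ∑ v, p v = 0 := hq
    have : ∀ a, Phi (Fin (2 * n)) (d, p) s(a, m.1 a) = p a + p (m.1 a) := by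
      intro a
      rw [Phi_apply]
      simp [(m.2.2 a).symm]
    simp only [this]
    rw [hsum, hq', mul_zero]

theorem finrank_span_inc {n : ℕ} (hn : 2 ≤ n) :
    Module.finrank ℝ (Submodule.span ℝ (Set.range (inc n))) =
      Nat.choose (2 * n) 2 - 2 * n + 1 := by
  have h1 := LinearMap.finrank_range_add_finrank_ker (Matrix.of (inc n)).mulVecLin
  have h2 := (Submodule.equivMapOfInjective (Phi (Fin (2 * n))) (Phi_inj hn)
    (LinearMap.ker (sumSnd (Fin (2 * n))))).finrank_eq
  have h3 := finrank_ker_sumSnd hn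
  have h4 := Matrix.rank_eq_finrank_span_row (Matrix.of (inc n))
  have h5 : Nat.choose (2 * n + 1) 2 = Nat.choose (2 * n) 2 + 2 * n := by
    rw [Nat.choose_succ_succ' (2 * n) 1, Nat.choose_one_right, add_comm]
  have h6 : 2 * n ≤ Nat.choose (2 * n) 2 := by
    rw [Nat.choose_two_right, Nat.le_div_iff_mul_le (by norm_num)]
    exact Nat.mul_le_mul_left _ (by omega)
  rw [ker_eq hn, ← h2, Module.finrank_fintype_fun_eq_card, Sym2.card, Fintype.card_fin, h5] at h1
  change Module.finrank ℝ (LinearMap.range (Matrix.of (inc n)).mulVecLin) =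
    Module.finrank ℝ (Submodule.span ℝ (Set.range (inc n))) at h4
  omega

theorem finrank_dir {n : ℕ} (hn : 2 ≤ n) :
    Module.finrank ℝ (affineSpan ℝ (Set.range (inc n))).direction + 1 =
      Module.finrank ℝ (Submodule.span ℝ (Set.range (inc n))) := by
  obtain ⟨m0⟩ := pm_exists n
  let φ : (Sym2 (Fin (2 * n)) → ℝ) →ₗ[ℝ] ℝ := ∑ e, LinearMap.proj e
  have hφ : ∀ m, φ (inc n m) = n := by
    intro m
    have := sum_inc m (fun _ => 1)
    simp at this
    simp [φ]
    linarith
  have hn0 : (n : ℝ) ≠ 0 := by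
    have : n ≠ 0 := by omega
    exact_mod_cast this
  rw [direction_affineSpan, vectorSpan_range_eq_span_range_vsub_right ℝ (inc n) m0]
  set D := Submodule.span ℝ (Set.range fun m => inc n m -ᵥ inc n m0) with hD
  have hDφ : D ≤ LinearMap.ker φ := by
    rw [hD, Submodule.span_le]
    rintro _ ⟨m, rfl⟩
    simp [hφ]
  have hx : inc n m0 ∉ D := fun h => by
    have := hDφ h
    rw [LinearMap.mem_ker, hφ] at this
    exact hn0 this
  have hx0 : inc n m0 ≠ 0 := fun h => hx (h ▸ D.zero_mem)
  have hsup : Submodule.span ℝ (Set.range (inc n)) = D ⊔ Submodule.span ℝ {inc n m0} := by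
    apply le_antisymm
    · rw [Submodule.span_le]
      rintro _ ⟨m, rfl⟩
      have : inc n m = (inc n m -ᵥ inc n m0) + inc n m0 := by simp
      rw [this]
      exact Submodule.add_mem_sup (Submodule.subset_span ⟨m, rfl⟩)
        (Submodule.mem_span_singleton_self _)
    · refine sup_le ?_ ?_
      · rw [hD, Submodule.span_le]
        rintro _ ⟨m, rfl⟩
        exact Submodule.sub_mem _ (Submodule.subset_span ⟨m, rfl⟩)
          (Submodule.subset_span ⟨m0, rfl⟩)
      · rw [Submodule.span_singleton_le_iff_mem]
        exact Submodule.subset_span ⟨m0, rfl⟩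
  have hdis : D ⊓ Submodule.span ℝ {inc n m0} = ⊥ := by
    rw [← disjoint_iff, Submodule.disjoint_span_singleton' hx0]
    exact hx
  have := Submodule.finrank_sup_add_finrank_inf_eq D (Submodule.span ℝ {inc n m0})
  rw [hdis, finrank_bot, finrank_span_singleton hx0, ← hsup] at this
  omega

/-- The perfect matching polytope of `K_{2n}` (the convex hull of the incidence
vectors of the perfect matchings) has dimension `C(2n,2) - 2n` — its affine span has
that dimension — and, equivalently, the maximum number of perfect matchings of
`K_{2n}` with linearly independent incidence vectors is `C(2n,2) - 2n + 1`. -/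
theorem dim_perfect_matching_polytope (n : ℕ) (hn : 2 ≤ n) :
    Module.finrank ℝ (affineSpan ℝ (Set.range (inc n))).direction =
        Nat.choose (2 * n) 2 - 2 * n ∧
    IsGreatest {k : ℕ | ∃ s : Finset (PMV n), s.card = k ∧
        LinearIndependent ℝ (fun m : {x // x ∈ s} => inc n m.1)}
      (Nat.choose (2 * n) 2 - 2 * n + 1) := by
  have hd := finrank_dir hn
  have hs := finrank_span_inc hn
  refine ⟨by omega, ?_, ?_⟩
  · obtain ⟨κ, a, ha, hsp, hli⟩ := exists_linearIndependent' ℝ (inc n)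
    have : Finite κ := Finite.of_injective a ha
    have : Fintype κ := Fintype.ofFinite κ
    refine ⟨Finset.univ.image a, ?_, ?_⟩
    · rw [Finset.card_image_of_injective _ ha, Finset.card_univ,
        ← finrank_span_eq_card hli, hsp, hs]
    · let e : κ ≃ {x // x ∈ Finset.univ.image a} :=
        (Equiv.ofInjective a ha).trans (Equiv.subtypeEquivRight (by simp))
      exact (linearIndependent_equiv' e rfl).1 hli
  · rintro k ⟨s, rfl, hli⟩
    rw [← hs, ← Fintype.card_coe s, ← finrank_span_eq_card hli]
    apply Submodule.finrank_mono
    apply Submodule.span_mono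
    rintro _ ⟨m, rfl⟩
    exact ⟨m.1, rfl⟩
end
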